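/- arXiv:1104.1672 — 4 statements merged into one kernel-verified Lean document; each statement's English description precedes it below -/
import Mathlib

section
/- Let ξ₁,…,ξₙ be random variables and for each i = 1,…,n let Xᵢ be a symmetric d×d real matrix-valued function of ξ₁,…,ξᵢ, where 𝔼ᵢ[·] denotes conditional expectation given ξ₁,…,ξᵢ₋₁. Suppose there exist b̄ > 0, σ̄ > 0, and k̄ > 0 such that almost surely, for all i = 1,…,n: 𝔼ᵢ[Xᵢ] = 0, λ_max(Xᵢ) ≤ b̄, λ_max((1/n) Σᵢ₌₁ⁿ 𝔼ᵢ[Xᵢ²]) ≤ σ̄², and 𝔼[tr((1/n) Σᵢ₌₁ⁿ 𝔼ᵢ[Xᵢ²])] ≤ σ̄²k̄. Then for any t > 0, Pr[λ_max((1/n) Σᵢ₌₁ⁿ Xᵢ) > √(2σ̄²t/n) + b̄t/(3n)] ≤ k̄ · t(eᵗ − t − 1)⁻¹. -/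
open MeasureTheory Matrix

/-- The largest eigenvalue of a (symmetric) real matrix. -/
noncomputable def lamMax {d : ℕ} (A : Matrix (Fin d) (Fin d) ℝ) : ℝ :=
  sSup {r : ℝ | ∃ v : Fin d → ℝ, v ≠ 0 ∧ A.mulVec v = r • v}

section

open Set Filter Topology

/-- `f` is integrable on `(0, ∞)` with integral `c`. -/
def HasIntegralIoi (f : ℝ → ℝ) (c : ℝ) : Prop :=
  IntegrableOn f (Ioi 0) ∧ ∫ s in Ioi 0, f s = c

namespace HasIntegralIoi

theorem congr {f g : ℝ → ℝ} {c e : ℝ} (hf : HasIntegralIoi f c)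
    (h : ∀ s, 0 < s → g s = f s) (hce : e = c) : HasIntegralIoi g e := by
  have h' : EqOn f g (Ioi 0) := fun s hs => (h s hs).symm
  refine ⟨hf.1.congr_fun h' measurableSet_Ioi, ?_⟩
  rw [← setIntegral_congr_fun measurableSet_Ioi h', hf.2, hce]

theorem add {f g : ℝ → ℝ} {c e : ℝ} (hf : HasIntegralIoi f c) (hg : HasIntegralIoi g e) :
    HasIntegralIoi (fun s => f s + g s) (c + e) :=
  ⟨hf.1.add hg.1, by rw [integral_add hf.1 hg.1, hf.2, hg.2]⟩

theorem sub {f g : ℝ → ℝ} {c e : ℝ} (hf : HasIntegralIoi f c) (hg : HasIntegralIoi g e) :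
    HasIntegralIoi (fun s => f s - g s) (c - e) :=
  ⟨hf.1.sub hg.1, by rw [integral_sub hf.1 hg.1, hf.2, hg.2]⟩

theorem const_mul {f : ℝ → ℝ} {c : ℝ} (hf : HasIntegralIoi f c) (r : ℝ) :
    HasIntegralIoi (fun s => r * f s) (r * c) :=
  ⟨Integrable.const_mul hf.1 r, by rw [integral_const_mul, hf.2]⟩

theorem sum {ι : Type*} (t : Finset ι) {f : ι → ℝ → ℝ} {c : ι → ℝ}
    (hf : ∀ i, HasIntegralIoi (f i) (c i)) :
    HasIntegralIoi (fun s => ∑ i ∈ t, f i s) (∑ i ∈ t, c i) :=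
  ⟨integrable_finsetSum t fun i _ => (hf i).1, by
    rw [integral_finsetSum t fun i _ => (hf i).1]
    exact Finset.sum_congr rfl fun i _ => (hf i).2⟩

theorem mono {f g : ℝ → ℝ} {c e : ℝ} (hf : HasIntegralIoi f c) (hg : HasIntegralIoi g e)
    (h : ∀ s, 0 < s → f s ≤ g s) : c ≤ e := by
  rw [← hf.2, ← hg.2]
  exact setIntegral_mono_on hf.1 hg.1 measurableSet_Ioi h

theorem comp_mul_left {f : ℝ → ℝ} {c : ℝ} (hf : HasIntegralIoi f c) {r : ℝ} (hr : 0 < r) :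
    HasIntegralIoi (fun s => f (r * s)) (r⁻¹ * c) := by
  refine ⟨?_, ?_⟩
  · rw [integrableOn_Ioi_comp_mul_left_iff f 0 hr, mul_zero]
    exact hf.1
  · rw [integral_comp_mul_left_Ioi f 0 hr, mul_zero, hf.2, smul_eq_mul]

/-- Frullani-type integral `∫ ((s + x)⁻¹ - (s + 1)⁻¹) ds = -log x`. -/
theorem inv_add_sub_inv {x : ℝ} (hx : 0 < x) :
    HasIntegralIoi (fun s => (s + x)⁻¹ - (s + 1)⁻¹) (-Real.log x) := by
  have hderiv : ∀ s ∈ Ici (0 : ℝ), HasDerivAt (fun s => Real.log (s + x) - Real.log (s + 1))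
      ((s + x)⁻¹ - (s + 1)⁻¹) s := by
    intro s hs
    have hs : 0 ≤ s := hs
    have h1 := ((hasDerivAt_id s).add_const x).log (by simp; positivity)
    have h2 := ((hasDerivAt_id s).add_const 1).log (by simp; positivity)
    simpa [Pi.sub_def] using h1.sub h2
  have hlim : Tendsto (fun s : ℝ => Real.log (s + x) - Real.log (s + 1)) atTop (𝓝 0) := by
    have h1 : Tendsto (fun s : ℝ => 1 + (x - 1) * (s + 1)⁻¹) atTop (𝓝 (1 + (x - 1) * 0)) :=
      ((tendsto_inv_atTop_zero.comp
        (tendsto_atTop_add_const_right _ 1 tendsto_id)).const_mul _).const_add _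
    have h2 := (Real.continuousAt_log (x := 1 + (x - 1) * 0) (by simp)).tendsto.comp h1
    simp only [mul_zero, add_zero, Real.log_one] at h2
    refine h2.congr' ?_
    filter_upwards [eventually_gt_atTop 0] with s hs
    rw [← Real.log_div (by positivity) (by positivity), Function.comp_apply]
    congr 1
    field_simp
    ring
  have hval : ∀ c : ℝ, c = 0 - (Real.log (0 + x) - Real.log (0 + 1)) → c = -Real.log x := by
    rintro c rfl
    simp
  rcases le_total x 1 with h | h
  · have hpos : ∀ s ∈ Ioi (0 : ℝ), 0 ≤ (s + x)⁻¹ - (s + 1)⁻¹ := by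
      intro s hs
      have hs : 0 < s := hs
      have : (s + 1)⁻¹ ≤ (s + x)⁻¹ := by gcongr
      linarith
    exact ⟨integrableOn_Ioi_deriv_of_nonneg' hderiv hpos hlim,
      hval _ (integral_Ioi_of_hasDerivAt_of_nonneg' hderiv hpos hlim)⟩
  · have hneg : ∀ s ∈ Ioi (0 : ℝ), (s + x)⁻¹ - (s + 1)⁻¹ ≤ 0 := by
      intro s hs
      have hs : 0 < s := hs
      have : (s + x)⁻¹ ≤ (s + 1)⁻¹ := by gcongr
      linarith
    exact ⟨integrableOn_Ioi_deriv_of_nonpos' hderiv hneg hlim,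
      hval _ (integral_Ioi_of_hasDerivAt_of_nonpos' hderiv hneg hlim)⟩

theorem inv_add_sq {x : ℝ} (hx : 0 < x) :
    HasIntegralIoi (fun s => (s + x)⁻¹ * (s + x)⁻¹) x⁻¹ := by
  have hderiv : ∀ s ∈ Ici (0 : ℝ), HasDerivAt (fun s => -(s + x)⁻¹)
      ((s + x)⁻¹ * (s + x)⁻¹) s := by
    intro s hs
    have hs : 0 ≤ s := hs
    have h1 := (((hasDerivAt_id s).add_const x).inv (by simp; positivity)).neg
    refine h1.congr_deriv ?_
    rw [neg_div, neg_neg, one_div, sq, mul_inv]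
    rfl
  have hlim : Tendsto (fun s : ℝ => -(s + x)⁻¹) atTop (𝓝 0) := by
    simpa using (tendsto_inv_atTop_zero.comp
      (tendsto_atTop_add_const_right _ x tendsto_id)).neg
  have hpos : ∀ s ∈ Ioi (0 : ℝ), 0 ≤ (s + x)⁻¹ * (s + x)⁻¹ := fun s _ => mul_self_nonneg _
  refine ⟨integrableOn_Ioi_deriv_of_nonneg' hderiv hpos hlim, ?_⟩
  rw [integral_Ioi_of_hasDerivAt_of_nonneg' hderiv hpos hlim]
  simp

theorem exists_inv_add_mul_inv_add {x y : ℝ} (hx : 0 < x) (hy : 0 < y) :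
    ∃ c, HasIntegralIoi (fun s => (s + x)⁻¹ * (s + y)⁻¹) c := by
  by_cases h : x = y
  · subst h
    exact ⟨_, inv_add_sq hx⟩
  · refine ⟨_, (((inv_add_sub_inv hx).sub (inv_add_sub_inv hy)).const_mul (y - x)⁻¹).congr
      (fun s hs => ?_) rfl⟩
    have : y - x ≠ 0 := sub_ne_zero.2 (Ne.symm h)
    field_simp
    ring

/-- The integrals of the kernel below split into `-log b` and a part independent of `b`. -/
theorem exists_lieb_kernel {x y : ℝ} (hx : 0 < x) (hy : 0 < y) :
    ∃ κ : ℝ, (x = y → κ = 1 - Real.log x) ∧ ∀ b : ℝ, 0 < b →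
      HasIntegralIoi (fun s => (s + b * x)⁻¹ + (s + b * y)⁻¹
        - s * ((s + b * x)⁻¹ * (s + b * y)⁻¹) - (s + 1)⁻¹) (κ - Real.log b) := by
  by_cases h : x = y
  · subst h
    refine ⟨1 - Real.log x, fun _ => rfl, fun b hb => ?_⟩
    have hbx : 0 < b * x := by positivity
    refine ((inv_add_sub_inv hbx).add ((inv_add_sq hbx).const_mul (b * x))).congr
      (fun s hs => ?_) ?_
    · field_simp
      ring
    · rw [Real.log_mul hb.ne' hx.ne']
      field_simp
      ring
  · have hxy : y - x ≠ 0 := sub_ne_zero.2 (Ne.symm h)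
    refine ⟨(y - x)⁻¹ * (y * (-Real.log x) - x * (-Real.log y)), fun h' => absurd h' h,
      fun b hb => ?_⟩
    have hbx : 0 < b * x := by positivity
    have hby : 0 < b * y := by positivity
    refine ((((inv_add_sub_inv hbx).const_mul y).sub
      ((inv_add_sub_inv hby).const_mul x)).const_mul (y - x)⁻¹).congr (fun s hs => ?_) ?_
    · field_simp
      ring
    · rw [Real.log_mul hb.ne' hx.ne', Real.log_mul hb.ne' hy.ne']
      field_simp
      ring

end HasIntegralIoi

section Spectral

variable {ι : Type*} [Fintype ι] [DecidableEq ι]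

/-- The matrix `U * diagonal f * Uᵀ`. -/
def orthConj (U : Matrix ι ι ℝ) (f : ι → ℝ) : Matrix ι ι ℝ :=
  U * diagonal f * Uᵀ

theorem exists_eq_orthConj {A : Matrix ι ι ℝ} (hA : A.IsSymm) :
    ∃ (U : Matrix ι ι ℝ) (f : ι → ℝ), Uᵀ * U = 1 ∧ A = orthConj U f := by
  have hH : A.IsHermitian := by
    rw [IsHermitian, conjTranspose_eq_transpose_of_trivial]
    exact hA
  refine ⟨hH.eigenvectorUnitary, hH.eigenvalues, ?_, ?_⟩
  · have := Unitary.coe_star_mul_self hH.eigenvectorUnitary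
    rwa [star_eq_conjTranspose, conjTranspose_eq_transpose_of_trivial] at this
  · have := hH.spectral_theorem
    rw [Unitary.conjStarAlgAut_apply] at this
    simpa [star_eq_conjTranspose, conjTranspose_eq_transpose_of_trivial, orthConj,
      Function.comp_def] using this

theorem orthConj_transpose (U : Matrix ι ι ℝ) (f : ι → ℝ) : (orthConj U f)ᵀ = orthConj U f := by
  simp [orthConj, Matrix.mul_assoc]

theorem orthConj_mul {U : Matrix ι ι ℝ} (hU : Uᵀ * U = 1) (f g : ι → ℝ) :
    orthConj U f * orthConj U g = orthConj U (fun i => f i * g i) := by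
  calc orthConj U f * orthConj U g = U * diagonal f * (Uᵀ * U) * diagonal g * Uᵀ := by
        simp only [orthConj, Matrix.mul_assoc]
    _ = orthConj U (fun i => f i * g i) := by
        rw [hU, Matrix.mul_one, Matrix.mul_assoc U, diagonal_mul_diagonal, orthConj]

theorem orthConj_const {U : Matrix ι ι ℝ} (hU : Uᵀ * U = 1) (r : ℝ) :
    orthConj U (fun _ => r) = r • (1 : Matrix ι ι ℝ) := by
  have h : diagonal (fun _ : ι => r) = r • (1 : Matrix ι ι ℝ) := by
    rw [← diagonal_one, ← diagonal_smul]; congr 1; ext; simp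
  rw [orthConj, h, Matrix.mul_smul, Matrix.smul_mul, Matrix.mul_one, mul_eq_one_comm.1 hU]

theorem orthConj_add (U : Matrix ι ι ℝ) (f g : ι → ℝ) :
    orthConj U f + orthConj U g = orthConj U (fun i => f i + g i) := by
  rw [orthConj, orthConj, orthConj, ← Matrix.add_mul, ← Matrix.mul_add, diagonal_add]

theorem smul_orthConj (r : ℝ) (U : Matrix ι ι ℝ) (f : ι → ℝ) :
    r • orthConj U f = orthConj U (fun i => r * f i) := by
  have h : diagonal (fun i => r * f i) = r • diagonal f := by
    rw [← diagonal_smul]; rfl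
  rw [orthConj, orthConj, h, Matrix.mul_smul, Matrix.smul_mul]

theorem inv_orthConj_add_smul_one {U : Matrix ι ι ℝ} (hU : Uᵀ * U = 1) (f : ι → ℝ) (s : ℝ)
    (h : ∀ i, s + f i ≠ 0) :
    (orthConj U f + s • (1 : Matrix ι ι ℝ))⁻¹ = orthConj U (fun i => (s + f i)⁻¹) := by
  refine inv_eq_right_inv ?_
  rw [← orthConj_const hU s, orthConj_add, orthConj_mul hU, ← one_smul ℝ (1 : Matrix ι ι ℝ),
    ← orthConj_const hU 1]
  congr 1
  ext i
  rw [add_comm, mul_inv_cancel₀ (h i)]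

theorem exp_orthConj {U : Matrix ι ι ℝ} (hU : Uᵀ * U = 1) (f : ι → ℝ) :
    NormedSpace.exp (orthConj U f) = orthConj U (fun i => Real.exp (f i)) := by
  have hinv : U⁻¹ = Uᵀ := inv_eq_left_inv hU
  have hunit : IsUnit U := ⟨⟨U, Uᵀ, mul_eq_one_comm.1 hU, hU⟩, rfl⟩
  rw [orthConj, orthConj, ← hinv, exp_conj U _ hunit, exp_diagonal]
  congr 3
  ext i
  rw [Pi.coe_exp, Real.exp_eq_exp_ℝ]

theorem trace_mul_orthConj (B U : Matrix ι ι ℝ) (f : ι → ℝ) :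
    (B * orthConj U f).trace = ∑ i, f i * (Uᵀ * B * U) i i := by
  calc (B * orthConj U f).trace = (Uᵀ * B * U * diagonal f).trace := by
        rw [orthConj, ← Matrix.mul_assoc, trace_mul_comm]
        simp only [Matrix.mul_assoc]
    _ = ∑ i, f i * (Uᵀ * B * U) i i := by
        simp only [Matrix.trace, Matrix.diag, mul_diagonal, mul_comm]

theorem trace_orthConj {U : Matrix ι ι ℝ} (hU : Uᵀ * U = 1) (f : ι → ℝ) :
    (orthConj U f).trace = ∑ i, f i := by
  have := trace_mul_orthConj 1 U f
  rw [Matrix.one_mul, Matrix.mul_one, hU] at this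
  simpa using this

theorem trace_conj_orth {U : Matrix ι ι ℝ} (hU : Uᵀ * U = 1) (B : Matrix ι ι ℝ) :
    (Uᵀ * B * U).trace = B.trace := by
  rw [trace_mul_comm, ← Matrix.mul_assoc, mul_eq_one_comm.1 hU, Matrix.one_mul]

/-- Completing the square for the quadratic form `Z ↦ tr (Zᵀ A Z) + s tr (Z N Zᵀ)`. -/
theorem two_trace_sub_le {P Q : Matrix ι ι ℝ} (hP : Pᵀ * P = 1) (hQ : Qᵀ * Q = 1) {n a : ι → ℝ}
    (hn : ∀ i, 0 < n i) (ha : ∀ i, 0 < a i) (Z : Matrix ι ι ℝ) {s : ℝ} (hs : 0 < s) :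
    2 * (orthConj P n * Z).trace - (Zᵀ * orthConj Q a * Z).trace
        - s * (Z * orthConj P n * Zᵀ).trace
      ≤ ∑ i, ∑ l, (Qᵀ * P) l i ^ 2 * n i * (s + a l * (n i)⁻¹)⁻¹ := by
  have hQ' : Q * Qᵀ = 1 := mul_eq_one_comm.1 hQ
  have hP' : P * Pᵀ = 1 := mul_eq_one_comm.1 hP
  set c := Qᵀ * P with hc
  set z := Qᵀ * Z * P with hz
  have h1 : (orthConj P n * Z).trace = ∑ i, ∑ l, n i * (c l i * z l i) := by
    rw [trace_mul_comm, trace_mul_orthConj]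
    have : Pᵀ * Z * P = cᵀ * z := by
      calc Pᵀ * Z * P = Pᵀ * (Q * Qᵀ) * Z * P := by rw [hQ', Matrix.mul_one]
        _ = cᵀ * z := by simp [hc, hz, Matrix.mul_assoc]
    rw [this]
    simp only [Matrix.mul_apply, transpose_apply, Finset.mul_sum]
  have h2 : (Zᵀ * orthConj Q a * Z).trace = ∑ i, ∑ l, a l * (z l i * z l i) := by
    rw [trace_mul_comm, ← Matrix.mul_assoc, trace_mul_orthConj, Finset.sum_comm]
    have : Qᵀ * (Z * Zᵀ) * Q = z * zᵀ := by
      calc Qᵀ * (Z * Zᵀ) * Q = Qᵀ * Z * (P * Pᵀ) * Zᵀ * Q := by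
            rw [hP', Matrix.mul_one]; simp only [Matrix.mul_assoc]
        _ = z * zᵀ := by simp [hz, Matrix.mul_assoc]
    rw [this]
    simp only [Matrix.mul_apply, transpose_apply, Finset.mul_sum]
  have h3 : (Z * orthConj P n * Zᵀ).trace = ∑ i, ∑ l, n i * (z l i * z l i) := by
    rw [trace_mul_comm, ← Matrix.mul_assoc, trace_mul_orthConj]
    have : Pᵀ * (Zᵀ * Z) * P = zᵀ * z := by
      calc Pᵀ * (Zᵀ * Z) * P = Pᵀ * Zᵀ * (Q * Qᵀ) * Z * P := by
            rw [hQ', Matrix.mul_one]; simp only [Matrix.mul_assoc]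
        _ = zᵀ * z := by simp [hz, Matrix.mul_assoc]
    rw [this]
    simp only [Matrix.mul_apply, transpose_apply, Finset.mul_sum]
  rw [h1, h2, h3]
  simp only [Finset.mul_sum, ← Finset.sum_sub_distrib]
  refine Finset.sum_le_sum fun i _ => Finset.sum_le_sum fun l _ => ?_
  have hni := hn i
  have hal := ha l
  have hD : 0 < a l + s * n i := by positivity
  have hrw : c l i ^ 2 * n i * (s + a l * (n i)⁻¹)⁻¹ = (n i * c l i) ^ 2 / (a l + s * n i) := by
    field_simp
    ring
  rw [hrw, le_div_iff₀ hD]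
  nlinarith [sq_nonneg ((a l + s * n i) * z l i - n i * c l i)]

theorem hasIntegralIoi_relEntropy {P Q : Matrix ι ι ℝ} (hP : Pᵀ * P = 1) (hQ : Qᵀ * Q = 1)
    (f y : ι → ℝ) :
    HasIntegralIoi (fun s => ∑ i, ∑ l, (Qᵀ * P) l i ^ 2 * Real.exp (f i)
        * (s + Real.exp (y l) * (Real.exp (f i))⁻¹)⁻¹
        - (orthConj P fun i => Real.exp (f i)).trace * (s + 1)⁻¹)
      (((orthConj P fun i => Real.exp (f i)) * orthConj P f).trace
        - ((orthConj P fun i => Real.exp (f i)) * orthConj Q y).trace) := by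
  set c := Qᵀ * P with hc
  have hcc : ∀ i, ∑ l, c l i ^ 2 = 1 := by
    intro i
    have : cᵀ * c = 1 := by
      calc cᵀ * c = Pᵀ * (Q * Qᵀ) * P := by simp [hc, Matrix.mul_assoc]
        _ = 1 := by rw [mul_eq_one_comm.1 hQ, Matrix.mul_one, hP]
    have := congrFun (congrFun this i) i
    simpa [Matrix.mul_apply, sq] using this
  refine (HasIntegralIoi.sum Finset.univ fun i => HasIntegralIoi.sum Finset.univ fun l =>
    (HasIntegralIoi.inv_add_sub_inv (x := Real.exp (y l) * (Real.exp (f i))⁻¹)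
      (by positivity)).const_mul (c l i ^ 2 * Real.exp (f i))).congr (fun s hs => ?_) ?_
  · simp only [mul_sub, Finset.sum_sub_distrib]
    congr 1
    rw [trace_orthConj hP, Finset.sum_mul]
    refine Finset.sum_congr rfl fun i _ => ?_
    rw [← Finset.sum_mul, ← Finset.sum_mul, hcc, one_mul]
  · rw [orthConj_mul hP, trace_orthConj hP, trace_mul_orthConj]
    have h2 : ∀ l, (Qᵀ * (orthConj P fun i => Real.exp (f i)) * Q) l l
        = ∑ i, c l i ^ 2 * Real.exp (f i) := by
      intro l
      have : Qᵀ * (orthConj P fun i => Real.exp (f i)) * Q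
          = c * diagonal (fun i => Real.exp (f i)) * cᵀ := by
        simp [hc, orthConj, Matrix.mul_assoc]
      rw [this, Matrix.mul_apply]
      refine Finset.sum_congr rfl fun i _ => ?_
      rw [mul_diagonal, transpose_apply]
      ring
    have h1 : ∀ i, Real.exp (f i) * f i = ∑ l, c l i ^ 2 * (Real.exp (f i) * f i) := by
      intro i
      rw [← Finset.sum_mul, hcc, one_mul]
    rw [Finset.sum_congr rfl fun i _ => h1 i]
    simp only [h2, Finset.mul_sum]
    rw [Finset.sum_comm (f := fun l i => y l * (c l i ^ 2 * Real.exp (f i))),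
      ← Finset.sum_sub_distrib]
    refine Finset.sum_congr rfl fun i _ => ?_
    rw [← Finset.sum_sub_distrib]
    refine Finset.sum_congr rfl fun l _ => ?_
    rw [← Real.exp_neg, ← Real.exp_add, Real.log_exp]
    ring

/-- Resolvent integral paired with a matrix. -/
theorem hasIntegralIoi_resolvent (S M A : Matrix ι ι ℝ)
    {b : ι → ℝ} {κ : ι → ι → ℝ}
    (hκ : ∀ j j', HasIntegralIoi (fun s => (s + b j)⁻¹ * (s + b j')⁻¹) (κ j j')) :
    HasIntegralIoi (fun s => (orthConj S (fun j => (s + b j)⁻¹) * M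
        * orthConj S (fun j => (s + b j)⁻¹) * A).trace)
      (∑ j, ∑ j', (Sᵀ * M * S) j j' * (Sᵀ * A * S) j' j * κ j j') := by
  refine (HasIntegralIoi.sum Finset.univ fun j => HasIntegralIoi.sum Finset.univ fun j' =>
    (hκ j j').const_mul ((Sᵀ * M * S) j j' * (Sᵀ * A * S) j' j)).congr (fun s hs => ?_) rfl
  have h1 : ∀ D : Matrix ι ι ℝ, ((S * D * Sᵀ) * M * (S * D * Sᵀ) * A).trace
      = (D * (Sᵀ * M * S) * D * (Sᵀ * A * S)).trace := by
    intro D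
    have : (S * D * Sᵀ) * M * (S * D * Sᵀ) * A = S * (D * Sᵀ * M * S * D * Sᵀ * A) := by
      simp only [Matrix.mul_assoc]
    rw [this, trace_mul_comm]
    simp only [Matrix.mul_assoc]
  rw [orthConj, h1, Matrix.trace]
  refine Finset.sum_congr rfl fun j _ => ?_
  rw [Matrix.diag_apply, Matrix.mul_apply]
  refine Finset.sum_congr rfl fun j' _ => ?_
  rw [mul_diagonal, diagonal_mul]
  ring

theorem hasIntegralIoi_lieb_tangent {R S : Matrix ι ι ℝ} (hR : Rᵀ * R = 1) (hS : Sᵀ * S = 1)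
    (h w : ι → ℝ) {N : Matrix ι ι ℝ} (hN : Nᵀ = N) (A : Matrix ι ι ℝ) {κ : ι → ι → ℝ}
    (hκ : ∀ j j', HasIntegralIoi (fun s => (s + Real.exp (w j))⁻¹ * (s + Real.exp (w j'))⁻¹)
      (κ j j')) :
    ∃ Z : ℝ → Matrix ι ι ℝ, HasIntegralIoi (fun s => 2 * (N * Z s).trace
        - ((Z s)ᵀ * A * Z s).trace - s * (Z s * N * (Z s)ᵀ).trace - N.trace * (s + 1)⁻¹)
      ((N * orthConj R h).trace + N.trace - (N * orthConj S w).trace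
        - ∑ j, ∑ j', (Sᵀ * (orthConj R fun k => Real.exp (h k)) * S) j j'
            * (Sᵀ * A * S) j' j * κ j j') := by
  set u := Sᵀ * R with hu
  set N' := Rᵀ * N * R with hN'
  set A' := Sᵀ * A * S with hA'
  have hRR : R * Rᵀ = 1 := mul_eq_one_comm.1 hR
  have hSS : S * Sᵀ = 1 := mul_eq_one_comm.1 hS
  have hN's : ∀ k k', N' k k' = N' k' k := by
    intro k k'
    have : N'ᵀ = N' := by simp [hN', hN, Matrix.mul_assoc]
    exact (congrFun (congrFun this k) k').symm
  have huu : ∀ k k', ∑ j, u j k * u j k' = (1 : Matrix ι ι ℝ) k k' := by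
    intro k k'
    have : uᵀ * u = 1 := by
      calc uᵀ * u = Rᵀ * (S * Sᵀ) * R := by simp [hu, Matrix.mul_assoc]
        _ = 1 := by rw [hSS, Matrix.mul_one, hR]
    rw [← this]
    simp [Matrix.mul_apply]
  let z : ℝ → Matrix ι ι ℝ := fun s => Matrix.of fun j k =>
    u j k * (s + Real.exp (w j) * (Real.exp (h k))⁻¹)⁻¹
  have hκ' : ∀ k j j', HasIntegralIoi (fun s => (s + Real.exp (w j) * (Real.exp (h k))⁻¹)⁻¹
      * (s + Real.exp (w j') * (Real.exp (h k))⁻¹)⁻¹) (Real.exp (h k) * κ j j') := by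
    intro k j j'
    refine (((hκ j j').comp_mul_left (Real.exp_pos (h k))).const_mul
      (Real.exp (h k) ^ 2)).congr (fun s hs => ?_) ?_
    · have := Real.exp_pos (h k)
      have := Real.exp_pos (w j)
      have := Real.exp_pos (w j')
      field_simp
    · have := Real.exp_pos (h k)
      field_simp
  choose K hK1 hK2 using fun k k' => HasIntegralIoi.exists_lieb_kernel
    (x := (Real.exp (h k))⁻¹) (y := (Real.exp (h k'))⁻¹)
    (inv_pos.2 (Real.exp_pos _)) (inv_pos.2 (Real.exp_pos _))
  have t1 : ∀ s, 2 * (N * (S * z s * Rᵀ)).trace = ∑ k, ∑ k', ∑ j, N' k k' * (u j k * u j k' *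
      ((s + Real.exp (w j) * (Real.exp (h k))⁻¹)⁻¹
        + (s + Real.exp (w j) * (Real.exp (h k'))⁻¹)⁻¹)) := by
    intro s
    have e1 : (N * (S * z s * Rᵀ)).trace = (N' * (uᵀ * z s)).trace := by
      calc (N * (S * z s * Rᵀ)).trace = (N * S * z s * Rᵀ).trace := by
            simp only [Matrix.mul_assoc]
        _ = (Rᵀ * N * (R * Rᵀ) * S * z s).trace := by
            rw [trace_mul_comm, hRR, Matrix.mul_one]
            simp only [Matrix.mul_assoc]
        _ = (N' * (uᵀ * z s)).trace := by simp [hN', hu, Matrix.mul_assoc]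
    have e2 : (N' * (uᵀ * z s)).trace = ∑ k, ∑ k', ∑ j, N' k k' * (u j k * u j k' *
        (s + Real.exp (w j) * (Real.exp (h k))⁻¹)⁻¹) := by
      simp only [Matrix.trace, Matrix.diag_apply, Matrix.mul_apply (M := N'),
        Matrix.mul_apply (M := uᵀ), transpose_apply, Finset.mul_sum, z, Matrix.of_apply]
      refine Finset.sum_congr rfl fun k _ => Finset.sum_congr rfl fun k' _ =>
        Finset.sum_congr rfl fun j _ => ?_
      ring
    have e3 : (N' * (uᵀ * z s)).trace = ∑ k, ∑ k', ∑ j, N' k k' * (u j k * u j k' *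
        (s + Real.exp (w j) * (Real.exp (h k'))⁻¹)⁻¹) := by
      rw [e2, Finset.sum_comm]
      refine Finset.sum_congr rfl fun k _ => Finset.sum_congr rfl fun k' _ =>
        Finset.sum_congr rfl fun j _ => ?_
      rw [hN's k' k]
      ring
    rw [e1, two_mul]
    nth_rewrite 1 [e2]
    rw [e3]
    simp only [← Finset.sum_add_distrib]
    refine Finset.sum_congr rfl fun k _ => Finset.sum_congr rfl fun k' _ =>
      Finset.sum_congr rfl fun j _ => ?_
    ring
  have t2 : ∀ s, ((S * z s * Rᵀ)ᵀ * A * (S * z s * Rᵀ)).trace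
      = ∑ k, ∑ j, ∑ j', u j k * u j' k * A' j' j *
        ((s + Real.exp (w j) * (Real.exp (h k))⁻¹)⁻¹
        * (s + Real.exp (w j') * (Real.exp (h k))⁻¹)⁻¹) := by
    intro s
    have e1 : ((S * z s * Rᵀ)ᵀ * A * (S * z s * Rᵀ)).trace = ((z s)ᵀ * A' * z s).trace := by
      rw [← Matrix.mul_assoc, trace_mul_comm]
      calc (Rᵀ * ((S * z s * Rᵀ)ᵀ * A * (S * z s))).trace
          = ((Rᵀ * R) * (z s)ᵀ * (Sᵀ * A * S) * z s).trace := by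
            simp [Matrix.mul_assoc]
        _ = _ := by rw [hR, Matrix.one_mul]
    rw [e1]
    simp only [Matrix.trace, Matrix.diag_apply, Matrix.mul_apply (N := z s),
      Matrix.mul_apply (N := A'), transpose_apply, Finset.sum_mul, z, Matrix.of_apply]
    refine Finset.sum_congr rfl fun k _ => Finset.sum_congr rfl fun j _ =>
      Finset.sum_congr rfl fun j' _ => ?_
    ring
  have t3 : ∀ s, (S * z s * Rᵀ * N * (S * z s * Rᵀ)ᵀ).trace
      = ∑ k, ∑ k', ∑ j, N' k k' * (u j k * u j k' *
        ((s + Real.exp (w j) * (Real.exp (h k))⁻¹)⁻¹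
        * (s + Real.exp (w j) * (Real.exp (h k'))⁻¹)⁻¹)) := by
    intro s
    have e1 : (S * z s * Rᵀ * N * (S * z s * Rᵀ)ᵀ).trace = (N' * ((z s)ᵀ * z s)).trace := by
      calc (S * z s * Rᵀ * N * (S * z s * Rᵀ)ᵀ).trace
          = (S * (z s * N' * (z s)ᵀ * Sᵀ)).trace := by simp [hN', Matrix.mul_assoc]
        _ = (z s * N' * (z s)ᵀ * (Sᵀ * S)).trace := by
            rw [trace_mul_comm]; simp only [Matrix.mul_assoc]
        _ = _ := by
            rw [hS, Matrix.mul_one, Matrix.mul_assoc, trace_mul_comm, Matrix.mul_assoc]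
    rw [e1]
    simp only [Matrix.trace, Matrix.diag_apply, Matrix.mul_apply (M := N'),
      Matrix.mul_apply (N := z s), transpose_apply, Finset.mul_sum, z, Matrix.of_apply]
    refine Finset.sum_congr rfl fun k _ => Finset.sum_congr rfl fun k' _ =>
      Finset.sum_congr rfl fun j _ => ?_
    ring
  have t4 : N.trace = ∑ k, ∑ k', ∑ j, N' k k' * (u j k * u j k') := by
    rw [← trace_conj_orth hR N]
    refine Finset.sum_congr rfl fun k _ => ?_
    simp only [← Finset.mul_sum, huu, Matrix.one_apply]
    simp [hN']
  have t5 : (N * orthConj S w).trace = ∑ k, ∑ k', ∑ j, N' k k' * (u j k * u j k' * w j) := by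
    rw [trace_mul_orthConj]
    have e1 : Sᵀ * N * S = u * N' * uᵀ := by
      calc Sᵀ * N * S = Sᵀ * (R * Rᵀ) * N * (R * Rᵀ) * S := by
            rw [hRR, Matrix.mul_one, Matrix.mul_one]
        _ = u * N' * uᵀ := by simp [hu, hN', Matrix.mul_assoc]
    have e2 : ∀ j, w j * (Sᵀ * N * S) j j = ∑ k', ∑ k, N' k k' * (u j k * u j k' * w j) := by
      intro j
      rw [e1, Matrix.mul_apply, Finset.mul_sum]
      refine Finset.sum_congr rfl fun k' _ => ?_
      rw [Matrix.mul_apply, Finset.sum_mul, Finset.mul_sum]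
      refine Finset.sum_congr rfl fun k _ => ?_
      rw [transpose_apply]
      ring
    simp only [e2]
    rw [Finset.sum_comm]
    simp only [Finset.sum_comm (s := (Finset.univ : Finset ι)) (t := Finset.univ)
      (f := fun j k => N' k _ * (u j k * u j _ * w j))]
    rw [Finset.sum_comm]
  have t6 : ∑ k, ∑ k', ∑ j, N' k k' * (u j k * u j k' * K k k')
      = (N * orthConj R h).trace + N.trace := by
    rw [trace_mul_orthConj, ← trace_conj_orth hR N, Matrix.trace, ← Finset.sum_add_distrib]
    refine Finset.sum_congr rfl fun k _ => ?_
    simp only [← Finset.mul_sum, ← Finset.sum_mul, huu, Matrix.one_apply]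
    have : K k k = 1 + h k := by
      rw [hK1 k k rfl, Real.log_inv, Real.log_exp]
      ring
    simp [hN', this]
    ring
  have t7 : ∑ k, ∑ j, ∑ j', u j k * u j' k * A' j' j * (Real.exp (h k) * κ j j')
      = ∑ j, ∑ j', (Sᵀ * (orthConj R fun k => Real.exp (h k)) * S) j j' * A' j' j * κ j j' := by
    rw [Finset.sum_comm]
    refine Finset.sum_congr rfl fun j _ => ?_
    rw [Finset.sum_comm]
    refine Finset.sum_congr rfl fun j' _ => ?_
    have e1 : Sᵀ * (orthConj R fun k => Real.exp (h k)) * S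
        = u * diagonal (fun k => Real.exp (h k)) * uᵀ := by
      simp [hu, orthConj, Matrix.mul_assoc]
    rw [e1, Matrix.mul_apply, Finset.sum_mul, Finset.sum_mul]
    refine Finset.sum_congr rfl fun k _ => ?_
    rw [mul_diagonal, transpose_apply]
    ring
  refine ⟨fun s => S * z s * Rᵀ, ((HasIntegralIoi.sum Finset.univ fun k =>
    HasIntegralIoi.sum Finset.univ fun k' => HasIntegralIoi.sum Finset.univ fun j =>
      ((hK2 k k' (Real.exp (w j)) (Real.exp_pos _)).const_mul (u j k * u j k')).const_mul
        (N' k k')).sub (HasIntegralIoi.sum Finset.univ fun k =>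
    HasIntegralIoi.sum Finset.univ fun j => HasIntegralIoi.sum Finset.univ fun j' =>
      (hκ' k j j').const_mul (u j k * u j' k * A' j' j))).congr (fun s hs => ?_) ?_⟩
  · have reorder : ∀ a b c e : ℝ, a - b - c - e = a - c - e - b := fun _ _ _ _ => by ring
    rw [t1, t2, t3, t4, reorder]
    congr 1
    simp only [Finset.mul_sum, Finset.sum_mul, ← Finset.sum_sub_distrib]
    refine Finset.sum_congr rfl fun k _ => Finset.sum_congr rfl fun k' _ =>
      Finset.sum_congr rfl fun j _ => ?_
    ring
  · rw [t7, ← t6, t5]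
    congr 1
    simp only [← Finset.sum_sub_distrib, Real.log_exp]
    refine Finset.sum_congr rfl fun k _ => Finset.sum_congr rfl fun k' _ =>
      Finset.sum_congr rfl fun j _ => ?_
    ring

/-- Lieb's three-matrix extension of the Golden–Thompson inequality, in spectral form. -/
theorem trace_exp_le_of_eq {P Q R S : Matrix ι ι ℝ} (hP : Pᵀ * P = 1) (hQ : Qᵀ * Q = 1)
    (hR : Rᵀ * R = 1) (hS : Sᵀ * S = 1) {f y h w : ι → ℝ}
    (heq : orthConj P f = orthConj R h - orthConj S w + orthConj Q y) {κ : ι → ι → ℝ}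
    (hκ : ∀ j j', HasIntegralIoi (fun s => (s + Real.exp (w j))⁻¹ * (s + Real.exp (w j'))⁻¹)
      (κ j j')) :
    (orthConj P fun i => Real.exp (f i)).trace
      ≤ ∑ j, ∑ j', (Sᵀ * (orthConj R fun k => Real.exp (h k)) * S) j j'
            * (Sᵀ * (orthConj Q fun k => Real.exp (y k)) * S) j' j * κ j j' := by
  obtain ⟨Z, hZ⟩ := hasIntegralIoi_lieb_tangent hR hS h w
    (orthConj_transpose P fun i => Real.exp (f i)) (orthConj Q fun k => Real.exp (y k)) hκ
  have key := hZ.mono (hasIntegralIoi_relEntropy hP hQ f y) fun s hs =>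
    sub_le_sub_right (two_trace_sub_le hP hQ (fun _ => Real.exp_pos _)
      (fun _ => Real.exp_pos _) (Z s) hs) _
  rw [heq, Matrix.mul_add, Matrix.mul_sub, trace_add, trace_sub] at key
  linarith

theorem dotProduct_orthConj_mulVec (U : Matrix ι ι ℝ) (f v : ι → ℝ) :
    v ⬝ᵥ (orthConj U f *ᵥ v) = ∑ i, f i * (Uᵀ *ᵥ v) i ^ 2 := by
  rw [orthConj, ← mulVec_mulVec, ← mulVec_mulVec, dotProduct_mulVec, ← mulVec_transpose,
    dotProduct]
  refine Finset.sum_congr rfl fun i _ => ?_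
  rw [mulVec_diagonal]
  ring

theorem dotProduct_eq_sum_sq {U : Matrix ι ι ℝ} (hU : Uᵀ * U = 1) (v : ι → ℝ) :
    v ⬝ᵥ v = ∑ i, (Uᵀ *ᵥ v) i ^ 2 := by
  have := dotProduct_orthConj_mulVec U (fun _ => 1) v
  rw [orthConj_const hU, one_smul, one_mulVec] at this
  simpa using this

theorem conj_apply_eq_dotProduct {κ : Type*} [Fintype κ] (U B : Matrix κ κ ℝ) (i : κ) :
    (Uᵀ * B * U) i i = (Uᵀ i) ⬝ᵥ (B *ᵥ Uᵀ i) := by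
  rw [Matrix.mul_assoc, Matrix.mul_apply, dotProduct]
  refine Finset.sum_congr rfl fun j _ => ?_
  rw [Matrix.mul_apply, mulVec, dotProduct]
  rfl

theorem apply_eq_dotProduct_orthConj {U : Matrix ι ι ℝ} (hU : Uᵀ * U = 1) (f : ι → ℝ) (i : ι) :
    f i = Uᵀ i ⬝ᵥ (orthConj U f *ᵥ Uᵀ i) := by
  rw [← conj_apply_eq_dotProduct, orthConj]
  have : Uᵀ * (U * diagonal f * Uᵀ) * U = (Uᵀ * U) * diagonal f * (Uᵀ * U) := by
    simp only [Matrix.mul_assoc]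
  rw [this, hU, Matrix.one_mul, Matrix.mul_one, diagonal_apply_eq]

theorem col_dotProduct_self {U : Matrix ι ι ℝ} (hU : Uᵀ * U = 1) (i : ι) :
    Uᵀ i ⬝ᵥ Uᵀ i = 1 := by
  have := congrFun (congrFun hU i) i
  rwa [Matrix.mul_apply, one_apply_eq] at this

theorem trace_mul_orthConj_mono {G : Matrix ι ι ℝ} (hG : ∀ v, 0 ≤ v ⬝ᵥ (G *ᵥ v))
    (U : Matrix ι ι ℝ) {f g : ι → ℝ} (hfg : ∀ i, f i ≤ g i) :
    (G * orthConj U f).trace ≤ (G * orthConj U g).trace := by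
  rw [trace_mul_orthConj, trace_mul_orthConj]
  refine Finset.sum_le_sum fun i _ => mul_le_mul_of_nonneg_right (hfg i) ?_
  rw [conj_apply_eq_dotProduct]
  exact hG _

theorem abs_apply_le_trace {G : Matrix ι ι ℝ} (hGs : G.IsSymm) (hG : ∀ v, 0 ≤ v ⬝ᵥ (G *ᵥ v))
    (a b : ι) : |G a b| ≤ G.trace := by
  have hdiag : ∀ i, 0 ≤ G i i := fun i => by simpa using hG (Pi.single i 1)
  have hle : ∀ i, G i i ≤ G.trace := fun i =>
    Finset.single_le_sum (f := fun i => G i i) (fun j _ => hdiag j) (Finset.mem_univ i)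
  have h1 := hG (Pi.single a 1 + Pi.single b 1)
  have h2 := hG (Pi.single a 1 - Pi.single b 1)
  have hs : G b a = G a b := hGs.apply a b
  simp [mulVec_add, mulVec_sub, hs] at h1 h2
  have := hle a
  have := hle b
  rw [abs_le]
  constructor <;> linarith

/-- The supporting functional at `exp W` of the concave map `A ↦ tr exp (H - W + log A)`. -/
noncomputable def liebGradient (H W : Matrix ι ι ℝ) : Matrix ι ι ℝ :=
  Matrix.of fun a b => ∫ s in Ioi (0 : ℝ), ((NormedSpace.exp W + s • (1 : Matrix ι ι ℝ))⁻¹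
    * NormedSpace.exp H * (NormedSpace.exp W + s • (1 : Matrix ι ι ℝ))⁻¹) a b

theorem hasIntegralIoi_trace_mul_liebGradient {W : Matrix ι ι ℝ} (hW : W.IsSymm)
    (H A : Matrix ι ι ℝ) :
    HasIntegralIoi (fun s => ((NormedSpace.exp W + s • (1 : Matrix ι ι ℝ))⁻¹
      * NormedSpace.exp H * (NormedSpace.exp W + s • (1 : Matrix ι ι ℝ))⁻¹ * A).trace)
      (liebGradient H W * A).trace := by
  obtain ⟨S, w, hS, rfl⟩ := exists_eq_orthConj hW
  choose κ hκ using fun j j' => HasIntegralIoi.exists_inv_add_mul_inv_add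
    (Real.exp_pos (w j)) (Real.exp_pos (w j'))
  have hentry : ∀ a b, HasIntegralIoi (fun s =>
      ((NormedSpace.exp (orthConj S w) + s • (1 : Matrix ι ι ℝ))⁻¹ * NormedSpace.exp H
        * (NormedSpace.exp (orthConj S w) + s • (1 : Matrix ι ι ℝ))⁻¹) a b)
      (liebGradient H (orthConj S w) a b) := by
    intro a b
    refine ⟨((hasIntegralIoi_resolvent S (NormedSpace.exp H) (Matrix.single b a 1) hκ).congr
      (fun s hs => ?_) rfl).1, rfl⟩
    have := fun i => Real.exp_pos (w i)
    rw [exp_orthConj hS, inv_orthConj_add_smul_one hS _ _ fun i => (add_pos hs (this i)).ne']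
    simp [Matrix.trace_mul_single]
  exact (HasIntegralIoi.sum Finset.univ fun a => HasIntegralIoi.sum Finset.univ fun b =>
    (hentry a b).const_mul (A b a)).congr
    (fun s _ => by simp only [Matrix.trace, Matrix.diag_apply, Matrix.mul_apply (N := A), mul_comm])
    (by simp only [Matrix.trace, Matrix.diag_apply, Matrix.mul_apply (N := A), mul_comm])

theorem trace_exp_sub_add_le {H W Y : Matrix ι ι ℝ} (hH : H.IsSymm) (hW : W.IsSymm)
    (hY : Y.IsSymm) :
    (NormedSpace.exp (H - W + Y)).trace ≤ (liebGradient H W * NormedSpace.exp Y).trace := by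
  have hI := hasIntegralIoi_trace_mul_liebGradient hW H (NormedSpace.exp Y)
  obtain ⟨P, f, hP, hPf⟩ := exists_eq_orthConj ((hH.sub hW).add hY)
  obtain ⟨R, h, hR, rfl⟩ := exists_eq_orthConj hH
  obtain ⟨S, w, hS, rfl⟩ := exists_eq_orthConj hW
  obtain ⟨Q, y, hQ, rfl⟩ := exists_eq_orthConj hY
  choose κ hκ using fun j j' => HasIntegralIoi.exists_inv_add_mul_inv_add
    (Real.exp_pos (w j)) (Real.exp_pos (w j'))
  have key := trace_exp_le_of_eq hP hQ hR hS hPf.symm hκ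
  rw [hPf, exp_orthConj hP]
  refine key.trans_eq ?_
  refine ((hasIntegralIoi_resolvent S _ _ hκ).congr (fun s hs => ?_) rfl).2.symm.trans hI.2
  have := fun i => Real.exp_pos (w i)
  rw [exp_orthConj hS, inv_orthConj_add_smul_one hS _ _ fun i => (add_pos hs (this i)).ne',
    exp_orthConj hR, exp_orthConj hQ]

theorem trace_liebGradient_mul_exp (H : Matrix ι ι ℝ) {W : Matrix ι ι ℝ} (hW : W.IsSymm) :
    (liebGradient H W * NormedSpace.exp W).trace = (NormedSpace.exp H).trace := by
  have hI := hasIntegralIoi_trace_mul_liebGradient hW H (NormedSpace.exp W)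
  obtain ⟨S, w, hS, rfl⟩ := exists_eq_orthConj hW
  refine hI.2.symm.trans ((HasIntegralIoi.sum Finset.univ fun j =>
    (HasIntegralIoi.inv_add_sq (Real.exp_pos (w j))).const_mul (Real.exp (w j) *
      (Sᵀ * NormedSpace.exp H * S) j j)).congr (fun s hs => ?_) ?_).2
  · have := fun i => Real.exp_pos (w i)
    rw [exp_orthConj hS, inv_orthConj_add_smul_one hS _ _ fun i => (add_pos hs (this i)).ne',
      Matrix.mul_assoc, orthConj_mul hS, Matrix.mul_assoc, trace_mul_comm, Matrix.mul_assoc,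
      orthConj_mul hS, trace_mul_orthConj]
    refine Finset.sum_congr rfl fun i _ => ?_
    ring
  · rw [← trace_conj_orth hS (NormedSpace.exp H)]
    refine Finset.sum_congr rfl fun i _ => ?_
    have := Real.exp_pos (w i)
    rw [Matrix.diag_apply]
    field_simp

theorem liebGradient_isSymm {H W : Matrix ι ι ℝ} (hH : H.IsSymm) (hW : W.IsSymm) :
    (liebGradient H W).IsSymm := by
  refine IsSymm.ext fun a b => ?_
  simp only [liebGradient, Matrix.of_apply]
  congr 1
  ext s
  have h : ((NormedSpace.exp W + s • (1 : Matrix ι ι ℝ))⁻¹ * NormedSpace.exp H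
      * (NormedSpace.exp W + s • (1 : Matrix ι ι ℝ))⁻¹)ᵀ
      = (NormedSpace.exp W + s • (1 : Matrix ι ι ℝ))⁻¹ * NormedSpace.exp H
      * (NormedSpace.exp W + s • (1 : Matrix ι ι ℝ))⁻¹ := by
    simp only [transpose_mul, transpose_nonsing_inv, transpose_add, transpose_smul,
      transpose_one, hW.exp.eq, hH.exp.eq, Matrix.mul_assoc]
  exact congrFun (congrFun h a) b

theorem dotProduct_liebGradient_nonneg {H W : Matrix ι ι ℝ} (hH : H.IsSymm) (hW : W.IsSymm)
    (v : ι → ℝ) : 0 ≤ v ⬝ᵥ (liebGradient H W *ᵥ v) := by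
  have hI := hasIntegralIoi_trace_mul_liebGradient hW H (vecMulVec v v)
  rw [Matrix.mul_vecMulVec, trace_vecMulVec, dotProduct_comm] at hI
  rw [← hI.2]
  refine setIntegral_nonneg measurableSet_Ioi fun s _ => ?_
  rw [Matrix.mul_vecMulVec, trace_vecMulVec, dotProduct_comm]
  set B := (NormedSpace.exp W + s • (1 : Matrix ι ι ℝ))⁻¹ with hB
  have hBs : Bᵀ = B := by
    simp only [hB, transpose_nonsing_inv, transpose_add, transpose_smul, transpose_one, hW.exp.eq]
  rw [← mulVec_mulVec, ← mulVec_mulVec, dotProduct_mulVec, ← mulVec_transpose, hBs]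
  obtain ⟨R, h, hR, rfl⟩ := exists_eq_orthConj hH
  rw [exp_orthConj hR, dotProduct_orthConj_mulVec]
  exact Finset.sum_nonneg fun i _ => by positivity

theorem trace_exp_le {H : Matrix ι ι ℝ} (hH : H.IsSymm) {c : ℝ}
    (hc : ∀ v, v ⬝ᵥ (H *ᵥ v) ≤ c * (v ⬝ᵥ v)) :
    (NormedSpace.exp H).trace ≤ Fintype.card ι * Real.exp c := by
  obtain ⟨R, h, hR, rfl⟩ := exists_eq_orthConj hH
  rw [exp_orthConj hR, trace_orthConj hR]
  have : ∀ i ∈ Finset.univ, Real.exp (h i) ≤ Real.exp c := by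
    intro i _
    have := hc (Rᵀ i)
    rw [← apply_eq_dotProduct_orthConj hR, col_dotProduct_self hR, mul_one] at this
    exact Real.exp_le_exp.2 this
  simpa using Finset.sum_le_card_nsmul _ _ _ this

theorem trace_exp_nonneg {H : Matrix ι ι ℝ} (hH : H.IsSymm) : 0 ≤ (NormedSpace.exp H).trace := by
  obtain ⟨R, h, hR, rfl⟩ := exists_eq_orthConj hH
  rw [exp_orthConj hR, trace_orthConj hR]
  exact Finset.sum_nonneg fun i _ => (Real.exp_pos _).le

theorem trace_mul_exp_smul_le {G X : Matrix ι ι ℝ} (hG : ∀ v, 0 ≤ v ⬝ᵥ (G *ᵥ v))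
    (hX : X.IsSymm) {b η g : ℝ} (hb : ∀ v, v ⬝ᵥ (X *ᵥ v) ≤ b * (v ⬝ᵥ v))
    (hg : ∀ x ≤ b, Real.exp (η * x) ≤ 1 + η * x + g * x ^ 2) :
    (G * NormedSpace.exp (η • X)).trace ≤ (G * (1 + η • X + g • (X * X))).trace := by
  obtain ⟨U, x, hU, rfl⟩ := exists_eq_orthConj hX
  rw [orthConj_mul hU, smul_orthConj, smul_orthConj, exp_orthConj hU,
    ← one_smul ℝ (1 : Matrix ι ι ℝ), ← orthConj_const hU, orthConj_add, orthConj_add]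
  refine trace_mul_orthConj_mono hG U fun i => ?_
  have := hb (Uᵀ i)
  rw [← apply_eq_dotProduct_orthConj hU, col_dotProduct_self hU, mul_one] at this
  rw [← sq]
  exact hg _ this

theorem trace_mul_one_add_le {G W : Matrix ι ι ℝ} (hG : ∀ v, 0 ≤ v ⬝ᵥ (G *ᵥ v))
    (hW : W.IsSymm) : (G * (1 + W)).trace ≤ (G * NormedSpace.exp W).trace := by
  obtain ⟨U, x, hU, rfl⟩ := exists_eq_orthConj hW
  rw [exp_orthConj hU, ← one_smul ℝ (1 : Matrix ι ι ℝ), ← orthConj_const hU, orthConj_add]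
  refine trace_mul_orthConj_mono hG U fun i => ?_
  rw [add_comm]
  exact Real.add_one_le_exp _

theorem trace_le_trace_mul_exp {G W : Matrix ι ι ℝ} (hG : ∀ v, 0 ≤ v ⬝ᵥ (G *ᵥ v))
    (hW : W.IsSymm) (hW0 : ∀ v, 0 ≤ v ⬝ᵥ (W *ᵥ v)) :
    G.trace ≤ (G * NormedSpace.exp W).trace := by
  obtain ⟨U, x, hU, rfl⟩ := exists_eq_orthConj hW
  nth_rewrite 1 [← Matrix.mul_one G]
  rw [exp_orthConj hU, ← one_smul ℝ (1 : Matrix ι ι ℝ), ← orthConj_const hU]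
  refine trace_mul_orthConj_mono hG U fun i => ?_
  rw [apply_eq_dotProduct_orthConj hU x i]
  exact Real.one_le_exp (hW0 _)

/-- If some vector witnesses a Rayleigh quotient at least `t`, then
`tr (exp T - T - 1) ≥ exp t - t - 1`. -/
theorem le_trace_exp_sub {T : Matrix ι ι ℝ} (hT : T.IsSymm) {t : ℝ} (ht : 0 ≤ t) {v : ι → ℝ}
    (hv : v ≠ 0) (hvt : t * (v ⬝ᵥ v) ≤ v ⬝ᵥ (T *ᵥ v)) :
    Real.exp t - t - 1 ≤ (NormedSpace.exp T).trace - T.trace - Fintype.card ι := by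
  obtain ⟨U, x, hU, rfl⟩ := exists_eq_orthConj hT
  have hpos : 0 < v ⬝ᵥ v := by
    have := dotProduct_star_self_pos_iff.2 hv
    simpa using this
  obtain ⟨i, hi⟩ : ∃ i, t ≤ x i := by
    by_contra! hcon
    rw [dotProduct_orthConj_mulVec, dotProduct_eq_sum_sq hU, Finset.mul_sum] at hvt
    rw [dotProduct_eq_sum_sq hU] at hpos
    obtain ⟨i, -, hi⟩ := Finset.exists_lt_of_sum_lt
      (f := fun _ => (0 : ℝ)) (g := fun i => (Uᵀ *ᵥ v) i ^ 2) (by simpa using hpos)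
    refine absurd hvt (not_le.2 (Finset.sum_lt_sum (fun j _ => ?_) ⟨i, Finset.mem_univ i, ?_⟩))
    · exact mul_le_mul_of_nonneg_right (hcon j).le (sq_nonneg _)
    · exact mul_lt_mul_of_pos_right (hcon i) hi
  rw [exp_orthConj hU, trace_orthConj hU, trace_orthConj hU]
  have hsum : ∑ j, Real.exp (x j) - ∑ j, x j - (Fintype.card ι : ℝ)
      = ∑ j, (Real.exp (x j) - x j - 1) := by
    simp [Finset.sum_sub_distrib]
  rw [hsum]
  have hmono : Real.exp t - t - 1 ≤ Real.exp (x i) - x i - 1 := by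
    have h1 : Real.exp t * (x i - t + 1) ≤ Real.exp (x i) := by
      have := mul_le_mul_of_nonneg_left (Real.add_one_le_exp (x i - t)) (Real.exp_pos t).le
      rwa [← Real.exp_add, add_sub_cancel] at this
    have h2 : 1 ≤ Real.exp t := Real.one_le_exp ht
    nlinarith [mul_nonneg (sub_nonneg.2 h2) (sub_nonneg.2 hi)]
  refine hmono.trans (Finset.single_le_sum (f := fun j => Real.exp (x j) - x j - 1)
    (fun j _ => ?_) (Finset.mem_univ i))
  linarith [Real.add_one_le_exp (x j)]

end Spectral

theorem Real.exp_le_one_add_add_div {y : ℝ} (h0 : 0 ≤ y) (h3 : y < 3) :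
    Real.exp y ≤ 1 + y + y ^ 2 / (2 * (1 - y / 3)) := by
  have hs := NormedSpace.expSeries_div_hasSum_exp (𝔸 := ℝ) y
  rw [← Real.exp_eq_exp_ℝ] at hs
  have hs2 := (hasSum_nat_add_iff' 2).2 hs
  have hg := (hasSum_geometric_of_lt_one (r := y / 3) (by positivity) (by linarith)).mul_left
    (y ^ 2 / 2)
  have := hasSum_le (fun k => ?_) hs2 hg
  · simp [Finset.sum_range_succ] at this
    have e : y ^ 2 / (2 * (1 - y / 3)) = y ^ 2 / 2 * (1 - y / 3)⁻¹ := by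
      rw [div_mul_eq_div_div, div_eq_mul_inv _ (1 - y / 3)]
    rw [e]
    linarith
  · have hf : (2 * 3 ^ k : ℝ) ≤ (k + 2).factorial := by
      have := Nat.factorial_mul_pow_le_factorial (m := 2) (n := k)
      rw [add_comm k 2]
      exact_mod_cast this
    calc y ^ (k + 2) / (k + 2).factorial ≤ y ^ (k + 2) / (2 * 3 ^ k) := by gcongr
      _ = y ^ 2 / 2 * (y / 3) ^ k := by rw [div_pow]; field_simp; ring

theorem Real.exp_le_one_add_add_sq_div_two {y : ℝ} (h : y ≤ 0) :
    Real.exp y ≤ 1 + y + y ^ 2 / 2 := by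
  have h1 := Real.quadratic_le_exp_of_nonneg (neg_nonneg.2 h)
  have h2 : Real.exp y * Real.exp (-y) = 1 := by rw [← Real.exp_add, add_neg_cancel, Real.exp_zero]
  have h3 := Real.exp_pos y
  have h4 : 0 < 1 + -y + (-y) ^ 2 / 2 := by nlinarith
  have h5 : Real.exp y * (1 + -y + (-y) ^ 2 / 2) ≤ 1 := by nlinarith
  nlinarith [sq_nonneg (y ^ 2)]

/-- The scalar inequality behind Bernstein's bound. -/
theorem Real.exp_mul_le_of_le {b η x : ℝ} (hη : 0 < η) (hb : 0 < b) (hηb : η * (b / 3) < 1)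
    (hx : x ≤ b) :
    Real.exp (η * x) ≤ 1 + η * x + η ^ 2 / (2 * (1 - η * (b / 3))) * x ^ 2 := by
  have hd : 0 < 1 - η * (b / 3) := by linarith
  rcases le_total x 0 with h | h
  · refine (Real.exp_le_one_add_add_sq_div_two (mul_nonpos_of_nonneg_of_nonpos hη.le h)).trans ?_
    have h1 : η ^ 2 / 2 ≤ η ^ 2 / (2 * (1 - η * (b / 3))) := by
      apply div_le_div_of_nonneg_left (by positivity) (by positivity)
      nlinarith [mul_pos hη hb]
    have := mul_le_mul_of_nonneg_right h1 (sq_nonneg x)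
    linarith [mul_pow η x 2]
  · have hηx : η * x ≤ η * b := mul_le_mul_of_nonneg_left hx hη.le
    refine (Real.exp_le_one_add_add_div (mul_nonneg hη.le h) (by linarith)).trans ?_
    have h1 : (η * x) ^ 2 / (2 * (1 - η * x / 3)) ≤ (η * x) ^ 2 / (2 * (1 - η * (b / 3))) := by
      apply div_le_div_of_nonneg_left (by positivity) (by positivity)
      linarith
    have h2 : (η * x) ^ 2 / (2 * (1 - η * (b / 3))) = η ^ 2 / (2 * (1 - η * (b / 3))) * x ^ 2 := by
      ring
    linarith

theorem dotProduct_mulVec_le_of_lamMax_le {d : ℕ} {A : Matrix (Fin d) (Fin d) ℝ} (hA : A.IsSymm)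
    {c : ℝ} (hc : lamMax A ≤ c) (v : Fin d → ℝ) : v ⬝ᵥ (A *ᵥ v) ≤ c * (v ⬝ᵥ v) := by
  obtain ⟨U, f, hU, rfl⟩ := exists_eq_orthConj hA
  have hbdd : BddAbove {r : ℝ | ∃ v : Fin d → ℝ, v ≠ 0 ∧ (orthConj U f).mulVec v = r • v} := by
    refine ⟨∑ i, |f i|, ?_⟩
    rintro r ⟨v, hv, hr⟩
    have hpos : 0 < v ⬝ᵥ v := by simpa using dotProduct_star_self_pos_iff.2 hv
    have h1 := dotProduct_orthConj_mulVec U f v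
    rw [hr, dotProduct_smul, smul_eq_mul] at h1
    refine le_of_mul_le_mul_right ?_ hpos
    rw [h1, dotProduct_eq_sum_sq hU, Finset.mul_sum]
    refine Finset.sum_le_sum fun i _ => mul_le_mul_of_nonneg_right ?_ (sq_nonneg _)
    exact (le_abs_self _).trans
      (Finset.single_le_sum (f := fun i => |f i|) (fun j _ => abs_nonneg _) (Finset.mem_univ i))
  have hf : ∀ i, f i ≤ c := fun i => by
    refine (le_csSup hbdd ⟨Uᵀ i, fun h0 => ?_, ?_⟩).trans hc
    · have := col_dotProduct_self hU i
      simp [h0] at this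
    · have hUi : Uᵀ i = U *ᵥ Pi.single i 1 := by
        ext j; simp [Matrix.transpose_apply]
      rw [hUi, orthConj, mulVec_mulVec, Matrix.mul_assoc, hU, Matrix.mul_one, ← mulVec_mulVec,
        ← mulVec_smul]
      congr 1
      ext j
      by_cases hj : j = i
      · subst hj; simp [mulVec_diagonal]
      · simp [mulVec_diagonal, hj]
  rw [dotProduct_orthConj_mulVec, dotProduct_eq_sum_sq hU, Finset.mul_sum]
  exact Finset.sum_le_sum fun i _ => mul_le_mul_of_nonneg_right (hf i) (sq_nonneg _)

theorem exists_lt_dotProduct_mulVec_of_lt_lamMax {d : ℕ} {A : Matrix (Fin d) (Fin d) ℝ} {x : ℝ}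
    (hx : 0 ≤ x) (hA : x < lamMax A) :
    ∃ v : Fin d → ℝ, v ≠ 0 ∧ x * (v ⬝ᵥ v) < v ⬝ᵥ (A *ᵥ v) := by
  have hne : {r : ℝ | ∃ v : Fin d → ℝ, v ≠ 0 ∧ A.mulVec v = r • v}.Nonempty := by
    by_contra h
    rw [Set.not_nonempty_iff_eq_empty] at h
    rw [lamMax, h, Real.sSup_empty] at hA
    exact hA.not_ge hx
  obtain ⟨r, ⟨v, hv, hr⟩, hxr⟩ := exists_lt_of_lt_csSup hne hA
  refine ⟨v, hv, ?_⟩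
  rw [hr, dotProduct_smul, smul_eq_mul]
  exact mul_lt_mul_of_pos_right hxr (by simpa using dotProduct_star_self_pos_iff.2 hv)

section Measurability

variable {Ω ι : Type*} [MeasurableSpace Ω] [Fintype ι]

theorem measurable_of_continuous_of_measurable_entries {F : Matrix ι ι ℝ → ℝ} (hF : Continuous F)
    {M : Ω → Matrix ι ι ℝ} (hM : ∀ a b, Measurable fun ω => M ω a b) :
    Measurable fun ω => F (M ω) := by
  have hF' : Continuous fun N : ι → ι → ℝ => F (Matrix.of N) := hF
  exact hF'.measurable.comp (measurable_pi_iff.2 fun a => measurable_pi_iff.2 fun b => hM a b)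

theorem measurable_mul_apply {M N : Ω → Matrix ι ι ℝ} (hM : ∀ a b, Measurable fun ω => M ω a b)
    (hN : ∀ a b, Measurable fun ω => N ω a b) (a b : ι) :
    Measurable fun ω => (M ω * N ω) a b := by
  simp only [Matrix.mul_apply]
  exact Finset.measurable_sum _ fun j _ => (hM a j).mul (hN j b)

variable [DecidableEq ι]

open scoped Matrix.Norms.Operator in
theorem measurable_exp_apply {M : Ω → Matrix ι ι ℝ} (hM : ∀ a b, Measurable fun ω => M ω a b)
    (a b : ι) : Measurable fun ω => NormedSpace.exp (M ω) a b :=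
  measurable_of_continuous_of_measurable_entries (F := fun N => NormedSpace.exp N a b)
    (NormedSpace.exp_continuous.matrix_elem a b) hM

theorem measurable_inv_apply {M : Ω → Matrix ι ι ℝ} (hM : ∀ a b, Measurable fun ω => M ω a b)
    (a b : ι) : Measurable fun ω => (M ω)⁻¹ a b := by
  simp only [Matrix.inv_def, Ring.inverse_eq_inv', Matrix.smul_apply, smul_eq_mul]
  exact (measurable_of_continuous_of_measurable_entries (F := fun N => N.det)
    continuous_id.matrix_det hM).inv.mul
    (measurable_of_continuous_of_measurable_entries (F := fun N => N.adjugate a b)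
      (continuous_id.matrix_adjugate.matrix_elem a b) hM)

theorem measurable_liebGradient_apply {H W : Ω → Matrix ι ι ℝ}
    (hH : ∀ a b, Measurable fun ω => H ω a b) (hW : ∀ a b, Measurable fun ω => W ω a b)
    (a b : ι) : Measurable fun ω => liebGradient (H ω) (W ω) a b := by
  have hR : ∀ a b, Measurable fun p : Ω × ℝ =>
      (NormedSpace.exp (W p.1) + p.2 • (1 : Matrix ι ι ℝ))⁻¹ a b := by
    refine measurable_inv_apply fun a b => ?_
    simp only [Matrix.add_apply, Matrix.smul_apply, smul_eq_mul]
    exact ((measurable_exp_apply hW a b).comp measurable_fst).add (measurable_snd.mul_const _)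
  have hE : ∀ a b, Measurable fun p : Ω × ℝ => NormedSpace.exp (H p.1) a b := fun a b =>
    (measurable_exp_apply hH a b).comp measurable_fst
  exact (measurable_mul_apply (measurable_mul_apply hR hE) hR a
    b).stronglyMeasurable.integral_prod_right'.measurable

end Measurability

section Conditional

variable {Ω : Type*} {m m0 : MeasurableSpace Ω} {μ : Measure Ω}

theorem integral_mul_eq_of_ae_eq_condExp [IsFiniteMeasure μ] (hm : m ≤ m0) {f g h : Ω → ℝ} {C : ℝ}
    (hf : Measurable[m] f) (hfC : ∀ᵐ ω ∂μ, |f ω| ≤ C) (hg : Integrable g μ)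
    (hh : h =ᵐ[μ] μ[g | m]) :
    Integrable (fun ω => f ω * g ω) μ ∧ Integrable (fun ω => f ω * h ω) μ
      ∧ ∫ ω, f ω * g ω ∂μ = ∫ ω, f ω * h ω ∂μ := by
  have hfs : AEStronglyMeasurable f μ := (hf.mono hm le_rfl).aestronglyMeasurable
  have hh' : Integrable h μ := integrable_condExp.congr hh.symm
  have hfg : Integrable (fun ω => f ω * g ω) μ := hg.bdd_mul hfs hfC
  refine ⟨hfg, hh'.bdd_mul hfs hfC, ?_⟩
  rw [← integral_condExp hm]
  refine integral_congr_ae ?_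
  filter_upwards [condExp_stronglyMeasurable_mul_of_bound hm hf.stronglyMeasurable hg C hfC, hh]
    with ω h1 h2
  rw [h2]
  exact h1

variable {ι : Type*} [Fintype ι]

theorem integral_trace_mul_eq_of_ae_eq_condExp [IsFiniteMeasure μ] (hm : m ≤ m0)
    {G Y Z : Ω → Matrix ι ι ℝ} {C : ℝ}
    (hG : ∀ a b, Measurable[m] fun ω => G ω a b) (hGC : ∀ᵐ ω ∂μ, ∀ a b, |G ω a b| ≤ C)
    (hY : ∀ a b, Integrable (fun ω => Y ω a b) μ)
    (hZ : ∀ a b, (fun ω => Z ω a b) =ᵐ[μ] μ[fun ω => Y ω a b | m]) :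
    Integrable (fun ω => (G ω * Y ω).trace) μ ∧ Integrable (fun ω => (G ω * Z ω).trace) μ
      ∧ ∫ ω, (G ω * Y ω).trace ∂μ = ∫ ω, (G ω * Z ω).trace ∂μ := by
  have key := fun a b => integral_mul_eq_of_ae_eq_condExp hm (hG a b)
    (hGC.mono fun ω h => h a b) (hY b a) (hZ b a)
  simp only [Matrix.trace, Matrix.diag_apply, Matrix.mul_apply]
  refine ⟨integrable_finsetSum _ fun a _ => integrable_finsetSum _ fun b _ => (key a b).1,
    integrable_finsetSum _ fun a _ => integrable_finsetSum _ fun b _ => (key a b).2.1, ?_⟩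
  rw [integral_finsetSum _ fun a _ => integrable_finsetSum _ fun b _ => (key a b).1,
    integral_finsetSum _ fun a _ => integrable_finsetSum _ fun b _ => (key a b).2.1]
  refine Finset.sum_congr rfl fun a _ => ?_
  rw [integral_finsetSum _ fun b _ => (key a b).1, integral_finsetSum _ fun b _ => (key a b).2.1]
  exact Finset.sum_congr rfl fun b _ => (key a b).2.2

theorem ae_isSymm_of_ae_eq_condExp {Y Z : Ω → Matrix ι ι ℝ} (hY : ∀ ω, (Y ω).IsSymm)
    (hZ : ∀ a b, (fun ω => Z ω a b) =ᵐ[μ] μ[fun ω => Y ω a b | m]) :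
    ∀ᵐ ω ∂μ, (Z ω).IsSymm := by
  have h : ∀ᵐ ω ∂μ, ∀ a b, Z ω a b = Z ω b a := by
    refine ae_all_iff.2 fun a => ae_all_iff.2 fun b => ?_
    have hab : (fun ω => Y ω a b) = fun ω => Y ω b a := funext fun ω => (hY ω).apply b a
    filter_upwards [hZ a b, hZ b a] with ω h1 h2
    rw [h1, h2, hab]
  filter_upwards [h] with ω hω
  exact IsSymm.ext fun a b => hω b a

theorem ae_nonneg_of_ae_eq_condExp {Y Z : Ω → Matrix ι ι ℝ}
    (hY : ∀ ω v, 0 ≤ v ⬝ᵥ (Y ω *ᵥ v)) (hYi : ∀ a b, Integrable (fun ω => Y ω a b) μ)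
    (hZ : ∀ a b, (fun ω => Z ω a b) =ᵐ[μ] μ[fun ω => Y ω a b | m]) :
    ∀ᵐ ω ∂μ, ∀ v, 0 ≤ v ⬝ᵥ (Z ω *ᵥ v) := by
  have hquad : ∀ (M : Matrix ι ι ℝ) (v : ι → ℝ),
      v ⬝ᵥ (M *ᵥ v) = ∑ a, ∑ b, (v a * v b) * M a b := by
    intro M v
    simp only [dotProduct, mulVec, Finset.mul_sum]
    exact Finset.sum_congr rfl fun a _ => Finset.sum_congr rfl fun b _ => by ring
  have hfix : ∀ v, ∀ᵐ ω ∂μ, 0 ≤ v ⬝ᵥ (Z ω *ᵥ v) := by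
    intro v
    have hi : ∀ a b, Integrable ((v a * v b) • fun ω => Y ω a b) μ := fun a b =>
      (hYi a b).smul _
    have h1 : 0 ≤ᵐ[μ] μ[∑ a, ∑ b, (v a * v b) • (fun ω => Y ω a b) | m] := by
      refine condExp_nonneg (Filter.Eventually.of_forall fun ω => ?_)
      have := hY ω v
      rw [hquad] at this
      simpa [Finset.sum_apply] using this
    have h2 := condExp_finsetSum (s := Finset.univ) (f := fun a => ∑ b, (v a * v b) •
      (fun ω => Y ω a b)) (μ := μ) (fun a _ => integrable_finsetSum' _ fun b _ => hi a b) m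
    have h3 : ∀ᵐ ω ∂μ, ∀ a, (μ[∑ b, (v a * v b) • (fun ω => Y ω a b) | m]) ω
        = (∑ b, μ[(v a * v b) • (fun ω => Y ω a b) | m]) ω := ae_all_iff.2 fun a =>
      condExp_finsetSum (s := Finset.univ) (fun b _ => hi a b) m
    have h4 : ∀ᵐ ω ∂μ, ∀ a b, (μ[(v a * v b) • (fun ω => Y ω a b) | m]) ω
        = (v a * v b) * Z ω a b := by
      refine ae_all_iff.2 fun a => ae_all_iff.2 fun b => ?_
      filter_upwards [condExp_smul (μ := μ) (v a * v b) (fun ω => Y ω a b) m, hZ a b]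
        with ω e1 e2
      rw [e1, e2]
      rfl
    filter_upwards [h1, h2, h3, h4] with ω e1 e2 e3 e4
    rw [hquad]
    rw [e2] at e1
    simpa [Finset.sum_apply, e3, e4] using e1
  obtain ⟨s, hs, hd⟩ := TopologicalSpace.exists_countable_dense (ι → ℝ)
  have hall : ∀ᵐ ω ∂μ, ∀ v ∈ s, 0 ≤ v ⬝ᵥ (Z ω *ᵥ v) := (ae_ball_iff hs).2 fun v _ => hfix v
  filter_upwards [hall] with ω hω v
  have hcl : IsClosed {v : ι → ℝ | 0 ≤ v ⬝ᵥ (Z ω *ᵥ v)} :=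
    isClosed_le continuous_const
      (continuous_id.dotProduct (continuous_const.matrix_mulVec continuous_id))
  exact hcl.closure_subset_iff.2 hω (hd v)

variable [DecidableEq ι]

theorem integrable_trace_exp [IsFiniteMeasure μ] {H : Ω → Matrix ι ι ℝ} {c : ℝ}
    (hH : ∀ a b, Measurable fun ω => H ω a b) (hHs : ∀ᵐ ω ∂μ, (H ω).IsSymm)
    (hHc : ∀ᵐ ω ∂μ, ∀ v, v ⬝ᵥ (H ω *ᵥ v) ≤ c * (v ⬝ᵥ v)) :
    Integrable (fun ω => (NormedSpace.exp (H ω)).trace) μ := by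
  have hmeas : Measurable fun ω => (NormedSpace.exp (H ω)).trace :=
    Finset.measurable_sum _ fun a _ => measurable_exp_apply hH a a
  refine Integrable.of_bound hmeas.aestronglyMeasurable (Fintype.card ι * Real.exp c) ?_
  filter_upwards [hHs, hHc] with ω h1 h2
  rw [Real.norm_of_nonneg (trace_exp_nonneg h1)]
  exact trace_exp_le h1 h2

/-- One step of Tropp's supermartingale argument, with the sub-exponential compensator
replaced by the conditional second moment. -/
theorem integral_trace_exp_add_le [IsProbabilityMeasure μ] (hm : m ≤ m0)
    {H X V : Ω → Matrix ι ι ℝ} {b c η g : ℝ} (hg0 : 0 ≤ g)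
    (hg : ∀ x ≤ b, Real.exp (η * x) ≤ 1 + η * x + g * x ^ 2)
    (hH : ∀ a b, Measurable[m] fun ω => H ω a b) (hHs : ∀ᵐ ω ∂μ, (H ω).IsSymm)
    (hHc : ∀ᵐ ω ∂μ, ∀ v, v ⬝ᵥ (H ω *ᵥ v) ≤ c * (v ⬝ᵥ v))
    (hXs : ∀ ω, (X ω).IsSymm) (hXi : ∀ a b, Integrable (fun ω => X ω a b) μ)
    (hXXi : ∀ a b, Integrable (fun ω => (X ω * X ω) a b) μ)
    (hXm : ∀ a b, μ[fun ω => X ω a b | m] =ᵐ[μ] 0)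
    (hXb : ∀ᵐ ω ∂μ, ∀ v, v ⬝ᵥ (X ω *ᵥ v) ≤ b * (v ⬝ᵥ v))
    (hVm : ∀ a b, Measurable[m] fun ω => V ω a b)
    (hV : ∀ a b, (fun ω => V ω a b) =ᵐ[μ] μ[fun ω => (X ω * X ω) a b | m])
    (hVs : ∀ᵐ ω ∂μ, (V ω).IsSymm) (hV0 : ∀ᵐ ω ∂μ, ∀ v, 0 ≤ v ⬝ᵥ (V ω *ᵥ v)) :
    ∫ ω, (NormedSpace.exp (H ω + (η • X ω - g • V ω))).trace ∂μ
      ≤ ∫ ω, (NormedSpace.exp (H ω)).trace ∂μ := by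
  set G : Ω → Matrix ι ι ℝ := fun ω => liebGradient (H ω) (g • V ω) with hGdef
  have hgVm : ∀ a b, Measurable[m] fun ω => (g • V ω) a b := fun a b => (hVm a b).const_mul g
  have hGm : ∀ a b, Measurable[m] fun ω => G ω a b :=
    @measurable_liebGradient_apply Ω ι m _ _ _ _ hH hgVm
  have hgV0 : ∀ᵐ ω ∂μ, ∀ v, 0 ≤ v ⬝ᵥ ((g • V ω) *ᵥ v) := by
    filter_upwards [hV0] with ω h v
    rw [smul_mulVec, dotProduct_smul]
    exact mul_nonneg hg0 (h v)
  have hGC : ∀ᵐ ω ∂μ, ∀ a b, |G ω a b| ≤ Fintype.card ι * Real.exp c := by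
    filter_upwards [hHs, hHc, hVs, hgV0] with ω h1 h2 h3 h4 a b
    have h3' := h3.smul g
    refine (abs_apply_le_trace (liebGradient_isSymm h1 h3')
      (dotProduct_liebGradient_nonneg h1 h3') a b).trans ?_
    refine (trace_le_trace_mul_exp (dotProduct_liebGradient_nonneg h1 h3') h3' h4).trans ?_
    rw [trace_liebGradient_mul_exp _ h3']
    exact trace_exp_le h1 h2
  have hYi : ∀ a b, Integrable (fun ω => (1 + η • X ω + g • (X ω * X ω)) a b) μ := fun a b =>
    ((integrable_const ((1 : Matrix ι ι ℝ) a b)).add ((hXi a b).const_mul η)).add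
      ((hXXi a b).const_mul g)
  have hYZ : ∀ a b, (fun ω => (1 + g • V ω) a b)
      =ᵐ[μ] μ[fun ω => (1 + η • X ω + g • (X ω * X ω)) a b | m] := by
    intro a b
    have e1 := condExp_add ((integrable_const (μ := μ) ((1 : Matrix ι ι ℝ) a b)).add
      ((hXi a b).smul η)) ((hXXi a b).smul g) m
    have e2 := condExp_add (integrable_const (μ := μ) ((1 : Matrix ι ι ℝ) a b))
      ((hXi a b).smul η) m
    filter_upwards [e1, e2, condExp_smul (μ := μ) η (fun ω => X ω a b) m,
      condExp_smul (μ := μ) g (fun ω => (X ω * X ω) a b) m, hV a b, hXm a b]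
      with ω h1 h2 h3 h4 h5 h6
    rw [condExp_const hm] at h2
    refine Eq.trans ?_ h1.symm
    rw [Pi.add_apply, h2, Pi.add_apply, h3, h4, Pi.smul_apply, Pi.smul_apply, h6, ← h5]
    simp
  obtain ⟨hi1, hi2, hint⟩ := integral_trace_mul_eq_of_ae_eq_condExp hm hGm hGC hYi hYZ
  calc ∫ ω, (NormedSpace.exp (H ω + (η • X ω - g • V ω))).trace ∂μ
      ≤ ∫ ω, (G ω * (1 + η • X ω + g • (X ω * X ω))).trace ∂μ := by
        refine integral_mono_of_nonneg ?_ hi1 ?_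
        · filter_upwards [hHs, hVs] with ω h1 h2
          exact trace_exp_nonneg (h1.add (((hXs ω).smul η).sub (h2.smul g)))
        · filter_upwards [hHs, hVs, hXb] with ω h1 h2 h3
          have e : H ω + (η • X ω - g • V ω) = H ω - g • V ω + η • X ω := by abel
          simp only [e]
          exact (trace_exp_sub_add_le h1 (h2.smul g) ((hXs ω).smul η)).trans
            (trace_mul_exp_smul_le (dotProduct_liebGradient_nonneg h1 (h2.smul g)) (hXs ω) h3 hg)
    _ = ∫ ω, (G ω * (1 + g • V ω)).trace ∂μ := hint
    _ ≤ ∫ ω, (NormedSpace.exp (H ω)).trace ∂μ := by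
        refine integral_mono_ae hi2
          (integrable_trace_exp (fun a b => (hH a b).mono hm le_rfl) hHs hHc) ?_
        filter_upwards [hHs, hVs] with ω h1 h2
        refine (trace_mul_one_add_le (dotProduct_liebGradient_nonneg h1 (h2.smul g))
          (h2.smul g)).trans_eq ?_
        exact trace_liebGradient_mul_exp _ (h2.smul g)

end Conditional

theorem exists_bernstein_params {b v t : ℝ} (hb : 0 < b) (hv : 0 < v) (ht : 0 < t) :
    ∃ η g : ℝ, 0 < η ∧ 0 ≤ g ∧
      (∀ x ≤ b, Real.exp (η * x) ≤ 1 + η * x + g * x ^ 2) ∧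
      η * (Real.sqrt (2 * v * t) + b * t / 3) - g * v = t ∧ g * v ≤ t := by
  set s := Real.sqrt (2 * t / v) with hs
  have hs0 : 0 < s := Real.sqrt_pos.2 (by positivity)
  have hs2 : s ^ 2 * v = 2 * t := by
    rw [hs, Real.sq_sqrt (by positivity)]
    field_simp
  have hsv : Real.sqrt (2 * v * t) = v * s := by
    rw [Real.sqrt_eq_iff_mul_self_eq (by positivity) (by positivity)]
    linear_combination -v * hs2
  have hD : 0 < 1 + b * s / 3 := by positivity
  have hη : 0 < s / (1 + b * s / 3) := by positivity
  have h1 : 1 - s / (1 + b * s / 3) * (b / 3) = (1 + b * s / 3)⁻¹ := by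
    field_simp
    ring
  have hηb : s / (1 + b * s / 3) * (b / 3) < 1 := by
    have : 0 < (1 + b * s / 3)⁻¹ := by positivity
    linarith
  refine ⟨s / (1 + b * s / 3), s / (1 + b * s / 3) * s / 2, hη, by positivity, fun x hx => ?_, ?_,
    ?_⟩
  · refine (Real.exp_mul_le_of_le hη hb hηb hx).trans_eq ?_
    rw [h1]
    field_simp
  · rw [hsv]
    have : t = s ^ 2 * v / 2 := by linarith
    rw [this]
    field_simp
    ring
  · have h2 : s / (1 + b * s / 3) ≤ s := div_le_self hs0.le (by linarith [mul_pos hb hs0])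
    have := mul_le_mul_of_nonneg_right h2 (mul_nonneg hs0.le hv.le)
    linarith

theorem sum_isSymm {ι κ : Type*} {D : κ → Matrix ι ι ℝ} (s : Finset κ)
    (hD : ∀ j, (D j).IsSymm) : (∑ j ∈ s, D j).IsSymm := by
  rw [IsSymm, transpose_sum]
  exact Finset.sum_congr rfl fun j _ => hD j

theorem dotProduct_sum_mulVec_le {ι κ : Type*} [Fintype ι] {D : κ → Matrix ι ι ℝ} {c : ℝ}
    (s : Finset κ) (hD : ∀ j v, v ⬝ᵥ (D j *ᵥ v) ≤ c * (v ⬝ᵥ v)) (v : ι → ℝ) :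
    v ⬝ᵥ ((∑ j ∈ s, D j) *ᵥ v) ≤ s.card * c * (v ⬝ᵥ v) := by
  rw [sum_mulVec, dotProduct_sum, mul_assoc, ← nsmul_eq_mul]
  exact Finset.sum_le_card_nsmul _ _ _ fun j _ => hD j v

section Supermartingale

variable {Ω : Type*} {m0 : MeasurableSpace Ω} {μ : Measure Ω} [IsProbabilityMeasure μ]
  {ι : Type*} [Fintype ι] [DecidableEq ι] {n : ℕ}

theorem integral_trace_exp_sum_le (ℱ : Filtration ℕ m0) {X V : Fin n → Ω → Matrix ι ι ℝ}
    {b η g : ℝ} (hη : 0 ≤ η) (hg0 : 0 ≤ g)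
    (hg : ∀ x ≤ b, Real.exp (η * x) ≤ 1 + η * x + g * x ^ 2)
    (hXs : ∀ i ω, (X i ω).IsSymm)
    (hXmeas : ∀ i a b, Measurable[ℱ (i.val + 1)] fun ω => X i ω a b)
    (hXi : ∀ i a b, Integrable (fun ω => X i ω a b) μ)
    (hXXi : ∀ i a b, Integrable (fun ω => (X i ω * X i ω) a b) μ)
    (hVmeas : ∀ i a b, Measurable[ℱ i.val] fun ω => V i ω a b)
    (hV : ∀ i a b, (fun ω => V i ω a b) =ᵐ[μ] μ[fun ω => (X i ω * X i ω) a b | ℱ i.val])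
    (hXm : ∀ i a b, μ[fun ω => X i ω a b | ℱ i.val] =ᵐ[μ] 0)
    (hXb : ∀ i, ∀ᵐ ω ∂μ, ∀ v, v ⬝ᵥ (X i ω *ᵥ v) ≤ b * (v ⬝ᵥ v)) :
    Integrable (fun ω => (NormedSpace.exp (∑ i, (η • X i ω - g • V i ω))).trace) μ ∧
      ∫ ω, (NormedSpace.exp (∑ i, (η • X i ω - g • V i ω))).trace ∂μ ≤ Fintype.card ι := by
  have hVs : ∀ i, ∀ᵐ ω ∂μ, (V i ω).IsSymm := fun i =>
    ae_isSymm_of_ae_eq_condExp (Y := fun ω => X i ω * X i ω)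
      (fun ω => by rw [IsSymm, transpose_mul, (hXs i ω).eq]) (hV i)
  have hV0 : ∀ i, ∀ᵐ ω ∂μ, ∀ v, 0 ≤ v ⬝ᵥ (V i ω *ᵥ v) := fun i => by
    refine ae_nonneg_of_ae_eq_condExp (Y := fun ω => X i ω * X i ω) (fun ω v => ?_) (hXXi i) (hV i)
    rw [← mulVec_mulVec, dotProduct_mulVec, ← mulVec_transpose, (hXs i ω).eq]
    exact Finset.sum_nonneg fun j _ => mul_self_nonneg _
  have hDs : ∀ᵐ ω ∂μ, ∀ i, (η • X i ω - g • V i ω).IsSymm := by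
    filter_upwards [ae_all_iff.2 hVs] with ω h i
    exact ((hXs i ω).smul η).sub ((h i).smul g)
  have hDb : ∀ᵐ ω ∂μ, ∀ i v, v ⬝ᵥ ((η • X i ω - g • V i ω) *ᵥ v) ≤ η * b * (v ⬝ᵥ v) := by
    filter_upwards [ae_all_iff.2 hV0, ae_all_iff.2 hXb] with ω h1 h2 i v
    rw [sub_mulVec, dotProduct_sub, smul_mulVec, smul_mulVec, dotProduct_smul, dotProduct_smul,
      smul_eq_mul, smul_eq_mul]
    have := mul_nonneg hg0 (h1 i v)
    have := mul_le_mul_of_nonneg_left (h2 i v) hη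
    linarith
  have hDm : ∀ i a b, Measurable[ℱ (i.val + 1)] fun ω => (η • X i ω - g • V i ω) a b :=
    fun i a b => ((hXmeas i a b).const_mul η).sub
      (((hVmeas i a b).mono (ℱ.mono (Nat.le_succ _)) le_rfl).const_mul g)
  have hSm : ∀ (s : Finset (Fin n)) (k : ℕ), (∀ i ∈ s, i.val < k) →
      ∀ a b, Measurable[ℱ k] fun ω => (∑ i ∈ s, (η • X i ω - g • V i ω)) a b := by
    intro s k hsk a b
    simp only [Matrix.sum_apply]
    exact Finset.measurable_sum _ fun i hi => (hDm i a b).mono (ℱ.mono (hsk i hi)) le_rfl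
  have hSs : ∀ s : Finset (Fin n), ∀ᵐ ω ∂μ, (∑ i ∈ s, (η • X i ω - g • V i ω)).IsSymm := by
    intro s
    filter_upwards [hDs] with ω h
    exact sum_isSymm s h
  have hSb : ∀ s : Finset (Fin n), ∀ᵐ ω ∂μ, ∀ v, v ⬝ᵥ ((∑ i ∈ s, (η • X i ω - g • V i ω)) *ᵥ v)
      ≤ s.card * (η * b) * (v ⬝ᵥ v) := by
    intro s
    filter_upwards [hDb] with ω h
    exact dotProduct_sum_mulVec_le s h
  refine ⟨integrable_trace_exp (fun a b => (hSm Finset.univ n (fun i _ => i.2) a b).mono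
    (ℱ.le n) le_rfl) (hSs _) (hSb _), ?_⟩
  have hind : ∀ k ≤ n, ∫ ω, (NormedSpace.exp
      (∑ i : Fin n with i.val < k, (η • X i ω - g • V i ω))).trace ∂μ ≤ Fintype.card ι := by
    intro k
    induction k with
    | zero => intro _; simp [NormedSpace.exp_zero]
    | succ k ih =>
      intro hk
      have hins : (Finset.univ.filter fun i : Fin n => i.val < k + 1)
          = insert ⟨k, hk⟩ (Finset.univ.filter fun i : Fin n => i.val < k) := by
        ext i
        simp [Fin.ext_iff, Nat.le_iff_lt_or_eq, or_comm]
      refine le_trans (le_of_eq ?_) ((integral_trace_exp_add_le (ℱ.le k) hg0 hg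
        (hSm (Finset.univ.filter fun i : Fin n => i.val < k) k (by simp)) (hSs _) (hSb _)
        (hXs ⟨k, hk⟩) (hXi _) (hXXi _) (hXm ⟨k, hk⟩) (hXb _) (hVmeas ⟨k, hk⟩)
        (hV ⟨k, hk⟩) (hVs _)
        (hV0 _)).trans (ih (Nat.le_of_succ_le hk)))
      refine integral_congr_ae (Filter.Eventually.of_forall fun ω => ?_)
      simp only [hins]
      rw [Finset.sum_insert (by simp), add_comm]
  have := hind n le_rfl
  rwa [Finset.filter_true_of_mem fun i _ => i.2] at this

end Supermartingale

end

/-- **Theorem 5 (matrix Bernstein bound).**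
`ξ₁,…,ξₙ` generate the filtration `ℱ` (so `ℱ i = σ(ξ₁,…,ξᵢ)`); `X i` is a symmetric
`d×d` matrix-valued function of `ξ₁,…,ξ_{i+1}` (0-indexed), and `V i` is the
conditional second moment `𝔼ᵢ[(X i)²]` (a function of `ξ₁,…,ξᵢ`).  Assume almost
surely: `𝔼ᵢ[X i] = 0`, `λmax (X i) ≤ b̄`, `λmax ((1/n) ∑ᵢ 𝔼ᵢ[(X i)²]) ≤ σ̄²` and
`𝔼[tr ((1/n) ∑ᵢ 𝔼ᵢ[(X i)²])] ≤ σ̄²k̄`.  Then for any `t > 0`,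
`Pr[λmax ((1/n) ∑ᵢ X i) > √(2σ̄²t/n) + b̄t/(3n)] ≤ k̄ · t (eᵗ − t − 1)⁻¹`. -/
theorem matrix_bernstein_bound
    {Ω : Type*} {m0 : MeasurableSpace Ω} {μ : Measure Ω} [IsProbabilityMeasure μ]
    {d n : ℕ} (ℱ : Filtration ℕ m0)
    (X V : Fin n → Ω → Matrix (Fin d) (Fin d) ℝ)
    (bbar σbar kbar : ℝ) (hbbar : 0 < bbar) (hσbar : 0 < σbar) (hkbar : 0 < kbar)
    (hXsymm : ∀ i ω, (X i ω).IsSymm)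
    (hXmeas : ∀ (i : Fin n) (a b : Fin d),
      Measurable[ℱ (i.val + 1)] fun ω => X i ω a b)
    (hXint : ∀ (i : Fin n) (a b : Fin d),
      Integrable (fun ω => X i ω a b) μ)
    (hXsqint : ∀ (i : Fin n) (a b : Fin d),
      Integrable (fun ω => (X i ω * X i ω) a b) μ)
    (hVmeas : ∀ (i : Fin n) (a b : Fin d),
      Measurable[ℱ i.val] fun ω => V i ω a b)
    (hV : ∀ (i : Fin n) (a b : Fin d),
      (fun ω => V i ω a b) =ᵐ[μ] μ[fun ω => (X i ω * X i ω) a b | ℱ i.val])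
    (hXmean : ∀ (i : Fin n) (a b : Fin d),
      μ[fun ω => X i ω a b | ℱ i.val] =ᵐ[μ] 0)
    (hXbdd : ∀ i : Fin n, ∀ᵐ ω ∂μ, lamMax (X i ω) ≤ bbar)
    (hVlam : ∀ᵐ ω ∂μ, lamMax ((n : ℝ)⁻¹ • ∑ i, V i ω) ≤ σbar ^ 2)
    (hVtrint : Integrable (fun ω => ((n : ℝ)⁻¹ • ∑ i, V i ω).trace) μ)
    (hVtr : ∫ ω, ((n : ℝ)⁻¹ • ∑ i, V i ω).trace ∂μ ≤ σbar ^ 2 * kbar)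
    (t : ℝ) (ht : 0 < t) :
    μ {ω | lamMax ((n : ℝ)⁻¹ • ∑ i, X i ω)
        > Real.sqrt (2 * σbar ^ 2 * t / n) + bbar * t / (3 * n)}
      ≤ ENNReal.ofReal (kbar * (t * (Real.exp t - t - 1)⁻¹)) := by
  rcases Nat.eq_zero_or_pos n with rfl | hn
  · refine (measure_mono_null (fun ω hω => ?_) measure_empty).trans_le bot_le
    obtain ⟨v, -, hlt⟩ := exists_lt_dotProduct_mulVec_of_lt_lamMax (by positivity) hω
    simp at hlt
  have hn' : (0 : ℝ) < n := Nat.cast_pos.2 hn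
  obtain ⟨η, g, hη, hg0, hg, hηg, hgv⟩ :=
    exists_bernstein_params (v := n * σbar ^ 2) hbbar (by positivity) ht
  have hVs : ∀ i, ∀ᵐ ω ∂μ, (V i ω).IsSymm := fun i =>
    ae_isSymm_of_ae_eq_condExp (Y := fun ω => X i ω * X i ω)
      (fun ω => by rw [IsSymm, transpose_mul, (hXsymm i ω).eq]) (hV i)
  have hsum : ∀ ω, ∑ i, (η • X i ω - g • V i ω) = η • ∑ i, X i ω - g • ∑ i, V i ω := fun ω => by
    rw [Finset.sum_sub_distrib, Finset.smul_sum, Finset.smul_sum]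
  have hTs : ∀ᵐ ω ∂μ, (η • ∑ i, X i ω - g • ∑ i, V i ω).IsSymm := by
    filter_upwards [ae_all_iff.2 hVs] with ω h
    exact ((sum_isSymm _ fun i => hXsymm i ω).smul η).sub ((sum_isSymm _ h).smul g)
  obtain ⟨hEi, hEle⟩ := integral_trace_exp_sum_le ℱ hη.le hg0 hg hXsymm hXmeas hXint hXsqint
    hVmeas hV hXmean fun i => (hXbdd i).mono fun ω h v =>
      dotProduct_mulVec_le_of_lamMax_le (hXsymm i ω) h v
  simp only [hsum, Fintype.card_fin] at hEi hEle
  have hXtr : ∀ ω, (∑ i, X i ω).trace = ∑ i, ∑ a, X i ω a a := fun ω => by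
    rw [trace_sum]
    rfl
  have hXtri : Integrable (fun ω => (∑ i, X i ω).trace) μ := by
    simp only [hXtr]
    exact integrable_finsetSum _ fun i _ => integrable_finsetSum _ fun a _ => hXint i a a
  have hXtr0 : ∫ ω, (∑ i, X i ω).trace ∂μ = 0 := by
    simp only [hXtr]
    rw [integral_finsetSum _ fun i _ => integrable_finsetSum _ fun a _ => hXint i a a]
    refine Finset.sum_eq_zero fun i _ => ?_
    rw [integral_finsetSum _ fun a _ => hXint i a a]
    refine Finset.sum_eq_zero fun a _ => ?_
    rw [← integral_condExp (ℱ.le i.val), integral_congr_ae (hXmean i a a)]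
    simp
  have hVn : ∀ ω, (∑ i, V i ω).trace = n * ((n : ℝ)⁻¹ • ∑ i, V i ω).trace := fun ω => by
    rw [trace_smul, smul_eq_mul, mul_inv_cancel_left₀ hn'.ne']
  have hVtri : Integrable (fun ω => (∑ i, V i ω).trace) μ := by
    simp only [hVn]
    exact hVtrint.const_mul _
  have hVtrle : ∫ ω, (∑ i, V i ω).trace ∂μ ≤ n * (σbar ^ 2 * kbar) := by
    simp only [hVn]
    rw [integral_const_mul]
    exact mul_le_mul_of_nonneg_left hVtr hn'.le
  have hTtr : ∀ ω, (η • ∑ i, X i ω - g • ∑ i, V i ω).trace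
      = η * (∑ i, X i ω).trace - g * (∑ i, V i ω).trace := fun ω => by
    rw [trace_sub, trace_smul, trace_smul, smul_eq_mul, smul_eq_mul]
  set ψ : Ω → ℝ := fun ω => (NormedSpace.exp (η • ∑ i, X i ω - g • ∑ i, V i ω)).trace
    - (η • ∑ i, X i ω - g • ∑ i, V i ω).trace - d with hψ
  have hTi : Integrable (fun ω => (η • ∑ i, X i ω - g • ∑ i, V i ω).trace) μ := by
    simp only [hTtr]
    exact (hXtri.const_mul η).sub (hVtri.const_mul g)
  have hψi : Integrable ψ μ := (hEi.sub hTi).sub (integrable_const _)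
  have hψ0 : 0 ≤ᵐ[μ] ψ := by
    filter_upwards [hTs] with ω h
    have := trace_mul_one_add_le (G := 1) (fun v => by
      rw [one_mulVec]
      exact Finset.sum_nonneg fun j _ => mul_self_nonneg _) h
    rw [Matrix.one_mul, Matrix.one_mul, trace_add, trace_one, Fintype.card_fin] at this
    simp only [hψ, Pi.zero_apply]
    linarith
  have hψle : ∫ ω, ψ ω ∂μ ≤ t * kbar := by
    have h1 : ∫ ω, ψ ω ∂μ = ∫ ω, (NormedSpace.exp (η • ∑ i, X i ω - g • ∑ i, V i ω)).trace ∂μ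
        - ∫ ω, (η • ∑ i, X i ω - g • ∑ i, V i ω).trace ∂μ - d := by
      have hi : Integrable (fun ω => (NormedSpace.exp (η • ∑ i, X i ω - g • ∑ i, V i ω)).trace
          - (η • ∑ i, X i ω - g • ∑ i, V i ω).trace) μ := hEi.sub hTi
      rw [hψ, integral_sub hi (integrable_const _), integral_sub hEi hTi]
      simp
    have h2 : ∫ ω, (η • ∑ i, X i ω - g • ∑ i, V i ω).trace ∂μ
        = - (g * ∫ ω, (∑ i, V i ω).trace ∂μ) := by
      simp only [hTtr]
      rw [integral_sub (hXtri.const_mul η) (hVtri.const_mul g), integral_const_mul,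
        integral_const_mul, hXtr0]
      ring
    rw [h1, h2]
    have h3 := mul_le_mul_of_nonneg_left hVtrle hg0
    have h4 := mul_le_mul_of_nonneg_right hgv hkbar.le
    linarith
  have hpos : 0 < Real.exp t - t - 1 := by linarith [Real.add_one_lt_exp ht.ne']
  have hsub : {ω | lamMax ((n : ℝ)⁻¹ • ∑ i, X i ω)
      > Real.sqrt (2 * σbar ^ 2 * t / n) + bbar * t / (3 * n)}
      ≤ᵐ[μ] {ω | Real.exp t - t - 1 ≤ ψ ω} := by
    filter_upwards [hTs, ae_all_iff.2 hVs, hVlam] with ω h1 h2 h3 hω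
    obtain ⟨v, hv, hlt⟩ := exists_lt_dotProduct_mulVec_of_lt_lamMax (by positivity) hω
    have hVv := dotProduct_mulVec_le_of_lamMax_le ((sum_isSymm _ h2).smul _) h3 v
    have hT := le_trace_exp_sub h1 ht.le hv ?_
    · rwa [Fintype.card_fin] at hT
    rw [smul_mulVec, dotProduct_smul, smul_eq_mul, inv_mul_eq_div] at hlt hVv
    rw [lt_div_iff₀ hn'] at hlt
    rw [div_le_iff₀ hn'] at hVv
    rw [sub_mulVec, dotProduct_sub, smul_mulVec, smul_mulVec, dotProduct_smul, dotProduct_smul,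
      smul_eq_mul, smul_eq_mul]
    have hsq : Real.sqrt (2 * (n * σbar ^ 2) * t) = n * Real.sqrt (2 * σbar ^ 2 * t / n) := by
      rw [show 2 * (n * σbar ^ 2) * t = (n : ℝ) ^ 2 * (2 * σbar ^ 2 * t / n) by field_simp,
        Real.sqrt_mul (by positivity), Real.sqrt_sq hn'.le]
    have hbt : n * (bbar * t / (3 * n)) = bbar * t / 3 := by field_simp
    rw [hsq, ← hbt] at hηg
    calc t * (v ⬝ᵥ v) = η * ((Real.sqrt (2 * σbar ^ 2 * t / n) + bbar * t / (3 * n))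
          * (v ⬝ᵥ v) * n) - g * (σbar ^ 2 * (v ⬝ᵥ v) * n) := by
          linear_combination -(v ⬝ᵥ v) * hηg
      _ ≤ _ := sub_le_sub (mul_le_mul_of_nonneg_left hlt.le hη.le)
          (mul_le_mul_of_nonneg_left hVv hg0)
  refine (measure_mono_ae hsub).trans ?_
  rw [← ofReal_measureReal]
  refine ENNReal.ofReal_le_ofReal ?_
  have hmarkov := (mul_meas_ge_le_integral_of_nonneg hψ0 hψi (Real.exp t - t - 1)).trans hψle
  rw [← mul_assoc, ← div_eq_mul_inv, le_div_iff₀ hpos]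
  linarith
end

section
/- Let Z₁, Z₂, … be a (possibly dependent, countably infinite) sequence of real random variables such that for each i, 𝔼[exp(ηZᵢ)] ≤ exp(η²σᵢ²/2) for all η ∈ ℝ, where σᵢ > 0. Assume v := sup_i σᵢ² < ∞ and k := (1/v) Σᵢ σᵢ² < ∞. Then for any t > 0, Pr[sup_i Zᵢ > √(2vt)] ≤ k · t(eᵗ − t − 1)⁻¹. -/
open MeasureTheory

/-- Bernoulli's inequality `1 + s (eᵗ - 1) ≤ eᵗˢ` turned into a bound on `e⁻ᵗˢ` linear in `s⁻¹`. -/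
lemma exp_neg_mul_le_inv_mul {s t : ℝ} (hs : 1 ≤ s) (ht : 0 < t) :
    Real.exp (-(t * s)) ≤ s⁻¹ * (t * (Real.exp t - t - 1)⁻¹) := by
  have hbernoulli : 1 + s * (Real.exp t - 1) ≤ Real.exp (t * s) := by
    have h := one_add_mul_self_le_rpow_one_add
      (show -1 ≤ Real.exp t - 1 by linarith [Real.exp_pos t]) hs
    rwa [add_sub_cancel, ← Real.exp_mul] at h
  have hden : 0 < Real.exp t - t - 1 := by
    linarith [Real.add_one_lt_exp ht.ne']
  have hnum : Real.exp t - t - 1 ≤ t * (Real.exp t - 1) := by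
    have h := mul_le_mul_of_nonneg_right (Real.add_one_le_exp (-t)) (Real.exp_pos t).le
    rw [← Real.exp_add, neg_add_cancel, Real.exp_zero] at h
    linarith
  have hs0 : 0 < s := by linarith
  have hprod : s * (Real.exp t - t - 1) ≤ t * Real.exp (t * s) := by
    nlinarith [mul_le_mul_of_nonneg_left hnum hs0.le, mul_le_mul_of_nonneg_left hbernoulli ht.le]
  rw [Real.exp_neg, ← div_eq_mul_inv, ← div_eq_inv_mul, div_div, inv_eq_one_div,
    div_le_div_iff₀ (Real.exp_pos _) (mul_pos hden hs0)]
  linarith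

/-- **Example 6 (supremum of a subgaussian random process).**
`Z₁, Z₂, …` are (possibly dependent) real random variables, each subgaussian with
variance proxy `σᵢ²` (hence mean zero).  With `v := supᵢ σᵢ² < ∞` and
`k := (1/v) ∑ᵢ σᵢ² < ∞`, for any `t > 0`,
`Pr[supᵢ Zᵢ > √(2vt)] ≤ k · t (eᵗ − t − 1)⁻¹`.
(The event `supᵢ Zᵢ > c` is expressed as `∃ i, Zᵢ > c`.) -/
theorem sup_subgaussian_tail
    {Ω : Type*} [MeasurableSpace Ω] (μ : Measure Ω) [IsProbabilityMeasure μ]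
    (Z : ℕ → Ω → ℝ) (σ : ℕ → ℝ) (hσ : ∀ i, 0 < σ i)
    (hint : ∀ (i : ℕ) (η : ℝ), Integrable (fun ω => Real.exp (η * Z i ω)) μ)
    (hsub : ∀ (i : ℕ) (η : ℝ),
      ∫ ω, Real.exp (η * Z i ω) ∂μ ≤ Real.exp (η ^ 2 * σ i ^ 2 / 2))
    (hbdd : BddAbove (Set.range fun i => σ i ^ 2))
    (hsum : Summable fun i => σ i ^ 2)
    (v k : ℝ) (hv : v = ⨆ i, σ i ^ 2) (hk : k = (∑' i, σ i ^ 2) / v)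
    (t : ℝ) (ht : 0 < t) :
    μ {ω | ∃ i, Z i ω > Real.sqrt (2 * v * t)}
      ≤ ENNReal.ofReal (k * (t * (Real.exp t - t - 1)⁻¹)) := by
  have hle : ∀ i, σ i ^ 2 ≤ v := fun i => hv ▸ le_ciSup hbdd i
  have hpos : ∀ i, 0 < σ i ^ 2 := fun i => pow_pos (hσ i) 2
  have hv0 : 0 < v := (hpos 0).trans_le (hle 0)
  have hC : 0 ≤ t * (Real.exp t - t - 1)⁻¹ :=
    mul_nonneg ht.le (inv_nonneg.2 (by linarith [Real.add_one_le_exp t]))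
  have htail : ∀ i, μ {ω | Z i ω > Real.sqrt (2 * v * t)}
      ≤ ENNReal.ofReal (σ i ^ 2 / v * (t * (Real.exp t - t - 1)⁻¹)) := by
    intro i
    have hZ : ProbabilityTheory.HasSubgaussianMGF (Z i) (NNReal.mk (σ i ^ 2) (hpos i).le) μ :=
      ⟨hint i, fun η => (hsub i η).trans_eq (by
        rw [NNReal.coe_mk, mul_comm (σ i ^ 2)])⟩
    have hchernoff := hZ.measure_ge_le (Real.sqrt_nonneg (2 * v * t))
    have hexp : -Real.sqrt (2 * v * t) ^ 2 / (2 * σ i ^ 2) = -(t * (v / σ i ^ 2)) := by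
      rw [Real.sq_sqrt (by positivity)]
      have := (hpos i).ne'
      field_simp
    rw [NNReal.coe_mk, hexp] at hchernoff
    have hbound := exp_neg_mul_le_inv_mul ((one_le_div (hpos i)).2 (hle i)) ht
    rw [inv_div] at hbound
    calc μ {ω | Z i ω > Real.sqrt (2 * v * t)}
        ≤ μ {ω | Real.sqrt (2 * v * t) ≤ Z i ω} :=
          measure_mono (Set.ofPred_subset_ofPred.2 fun _ hω => le_of_lt hω)
      _ = ENNReal.ofReal (μ.real {ω | Real.sqrt (2 * v * t) ≤ Z i ω}) :=
          (ofReal_measureReal).symm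
      _ ≤ _ := ENNReal.ofReal_le_ofReal (hchernoff.trans hbound)
  calc μ {ω | ∃ i, Z i ω > Real.sqrt (2 * v * t)}
      = μ (⋃ i, {ω | Z i ω > Real.sqrt (2 * v * t)}) := by rw [Set.ofPred_exists]
    _ ≤ ∑' i, μ {ω | Z i ω > Real.sqrt (2 * v * t)} := measure_iUnion_le _
    _ ≤ ∑' i, ENNReal.ofReal (σ i ^ 2 / v * (t * (Real.exp t - t - 1)⁻¹)) :=
        ENNReal.tsum_le_tsum htail
    _ = ENNReal.ofReal (k * (t * (Real.exp t - t - 1)⁻¹)) := by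
        rw [← ENNReal.ofReal_tsum_of_nonneg
          (fun i => mul_nonneg (div_nonneg (hpos i).le hv0.le) hC)
          ((hsum.div_const v).mul_right _), tsum_mul_right, tsum_div_const, hk]
end

section
/- Let Z₁, Z₂, … be a (possibly dependent, countably infinite) sequence of real random variables such that for each i, 𝔼[exp(ηZᵢ)] ≤ exp(η²σᵢ²/2) for all η ∈ ℝ, where σᵢ > 0. Assume v := sup_i σᵢ² < ∞, k := (1/v) Σᵢ σᵢ² < ∞, and log k ≥ 1.3. Then for any τ > 0, Pr[sup_i Zᵢ > 2√(v(log k + τ))] ≤ e^{−τ}. -/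
open MeasureTheory

/-- The Chernoff bound for a random variable with subgaussian moment generating function. -/
lemma measureReal_gt_le_of_subgaussian {Ω : Type*} [MeasurableSpace Ω] {μ : Measure Ω}
    [IsFiniteMeasure μ] {X : Ω → ℝ} {s t : ℝ} (hs : 0 < s) (ht : 0 ≤ t)
    (hint : ∀ η : ℝ, Integrable (fun ω => Real.exp (η * X ω)) μ)
    (hsub : ∀ η : ℝ, ∫ ω, Real.exp (η * X ω) ∂μ ≤ Real.exp (η ^ 2 * s / 2)) :
    μ.real {ω | X ω > t} ≤ Real.exp (-(t ^ 2 / (2 * s))) := by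
  calc μ.real {ω | X ω > t} ≤ μ.real {ω | t ≤ X ω} :=
        measureReal_mono fun ω (h : X ω > t) => h.le
    _ ≤ Real.exp (-(t / s) * t) * ProbabilityTheory.mgf X μ (t / s) :=
        ProbabilityTheory.measure_ge_le_exp_mul_mgf t (by positivity) (hint _)
    _ ≤ Real.exp (-(t / s) * t) * Real.exp ((t / s) ^ 2 * s / 2) := by
        gcongr
        exact hsub _
    _ = Real.exp (-(t ^ 2 / (2 * s))) := by
        rw [← Real.exp_add]
        congr 1
        field_simp
        ring

lemma exp_neg_mul_div_le {c s v : ℝ} (hc : 1 ≤ c) (hs : 0 < s) (hsv : s ≤ v) :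
    Real.exp (-(c * v / s)) ≤ s / v * Real.exp (-c) := by
  have hv : 0 < v := hs.trans_le hsv
  have h1 : 1 ≤ v / s := (one_le_div hs).2 hsv
  have h2 : v / s ≤ Real.exp (c * v / s - c) := by
    have h := Real.add_one_le_exp (v / s - 1)
    calc v / s ≤ Real.exp (v / s - 1) := by linarith
      _ ≤ Real.exp (c * v / s - c) := by
        rw [Real.exp_le_exp, mul_div_assoc]
        nlinarith
  have h3 : Real.exp (-c) = Real.exp (c * v / s - c) * Real.exp (-(c * v / s)) := by
    rw [← Real.exp_add]
    congr 1
    ring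
  calc Real.exp (-(c * v / s)) = s / v * (v / s * Real.exp (-(c * v / s))) := by
        field_simp
    _ ≤ s / v * Real.exp (-c) := by
        rw [h3]
        gcongr

/-- **Example 6, exponential-tail form.**
`Z₁, Z₂, …` are (possibly dependent) real random variables, each subgaussian with
variance proxy `σᵢ²` (hence mean zero).  With `v := supᵢ σᵢ² < ∞`,
`k := (1/v) ∑ᵢ σᵢ² < ∞` and `log k ≥ 1.3`, for any `τ > 0`,
`Pr[supᵢ Zᵢ > 2√(v(log k + τ))] ≤ e^{−τ}`.
(The event `supᵢ Zᵢ > c` is expressed as `∃ i, Zᵢ > c`.) -/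
theorem sup_subgaussian_exponential_tail
    {Ω : Type*} [MeasurableSpace Ω] (μ : Measure Ω) [IsProbabilityMeasure μ]
    (Z : ℕ → Ω → ℝ) (σ : ℕ → ℝ) (hσ : ∀ i, 0 < σ i)
    (hint : ∀ (i : ℕ) (η : ℝ), Integrable (fun ω => Real.exp (η * Z i ω)) μ)
    (hsub : ∀ (i : ℕ) (η : ℝ),
      ∫ ω, Real.exp (η * Z i ω) ∂μ ≤ Real.exp (η ^ 2 * σ i ^ 2 / 2))
    (hbdd : BddAbove (Set.range fun i => σ i ^ 2))
    (hsum : Summable fun i => σ i ^ 2)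
    (v k : ℝ) (hv : v = ⨆ i, σ i ^ 2) (hk : k = (∑' i, σ i ^ 2) / v)
    (hlogk : Real.log k ≥ 1.3)
    (τ : ℝ) (hτ : 0 < τ) :
    μ {ω | ∃ i, Z i ω > 2 * Real.sqrt (v * (Real.log k + τ))}
      ≤ ENNReal.ofReal (Real.exp (-τ)) := by
  have hle : ∀ i, σ i ^ 2 ≤ v := fun i => hv ▸ le_ciSup hbdd i
  have hpos : ∀ i, 0 < σ i ^ 2 := fun i => pow_pos (hσ i) 2
  have hv0 : 0 < v := (hpos 0).trans_le (hle 0)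
  have hk0 : 0 < k := hk ▸ div_pos (hsum.tsum_pos (fun i => (hpos i).le) 0 (hpos 0)) hv0
  set x := Real.log k + τ with hx
  have hx1 : 1.3 ≤ x := by linarith
  have hx0 : 0 ≤ v * x := mul_nonneg hv0.le (by linarith)
  have key : ∀ i, μ {ω | Z i ω > 2 * Real.sqrt (v * x)}
      ≤ ENNReal.ofReal (σ i ^ 2 / v * Real.exp (-(2 * x))) := fun i => by
    rw [← ofReal_measureReal]
    refine ENNReal.ofReal_le_ofReal ((measureReal_gt_le_of_subgaussian (hpos i) (by positivity)
      (hint i) (hsub i)).trans ?_)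
    refine le_trans (le_of_eq ?_) (exp_neg_mul_div_le (by linarith) (hpos i) (hle i))
    have hne := (hpos i).ne'
    rw [mul_pow, Real.sq_sqrt hx0]
    congr 2
    field_simp
  have hsum' : Summable fun i => σ i ^ 2 / v * Real.exp (-(2 * x)) :=
    (hsum.div_const v).mul_right _
  calc μ {ω | ∃ i, Z i ω > 2 * Real.sqrt (v * x)}
      ≤ ∑' i, μ {ω | Z i ω > 2 * Real.sqrt (v * x)} := by
        rw [Set.ofPred_exists]
        exact measure_iUnion_le _
    _ ≤ ∑' i, ENNReal.ofReal (σ i ^ 2 / v * Real.exp (-(2 * x))) := ENNReal.tsum_le_tsum key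
    _ = ENNReal.ofReal (k * Real.exp (-(2 * x))) := by
        rw [← ENNReal.ofReal_tsum_of_nonneg (fun i => by positivity) hsum', tsum_mul_right,
          tsum_div_const, ← hk]
    _ ≤ ENNReal.ofReal (Real.exp (-τ)) := by
        refine ENNReal.ofReal_le_ofReal ?_
        nth_rewrite 1 [← Real.exp_log hk0]
        rw [← Real.exp_add]
        gcongr
        linarith
end

section
/- Let Z be a real random variable such that, for some γ > 0, 𝔼[Z²] = 1 and Pr[Z² > t] ≤ 2·exp(−t/(2γ)) for all t ≥ 0. Then for every η with 0 ≤ η < 1/(2γ), 𝔼[exp(ηZ²)] ≤ exp(η + 8η²γ²/(1 − 2ηγ)). -/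
open MeasureTheory

/-- The second-order remainder of `exp (η x)`, as an integral of its derivative. -/
lemma intervalIntegral_mul_exp_sub_one (η x : ℝ) :
    ∫ t in (0 : ℝ)..x, η * (Real.exp (η * t) - 1) = Real.exp (η * x) - 1 - η * x := by
  have hderiv : ∀ t ∈ Set.uIcc 0 x,
      HasDerivAt (fun t => Real.exp (η * t) - η * t) (η * (Real.exp (η * t) - 1)) t := by
    intro t _
    have hlin : HasDerivAt (fun t : ℝ => η * t) η t := by
      simpa using (hasDerivAt_id t).const_mul η
    exact (hlin.exp.sub hlin).congr_deriv (by ring)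
  rw [intervalIntegral.integral_eq_sub_of_hasDerivAt hderiv
    (Continuous.intervalIntegrable (by fun_prop) _ _)]
  simp only [mul_zero, Real.exp_zero]
  ring

/-- If a nonnegative variable has tails at most `C exp (-a t)`, then the expectation of the
second-order remainder of its exponential at `η < a` is at most `C η² / (a (a - η))`. -/
lemma lintegral_exp_remainder_le_of_tail_bound
    {Ω : Type*} {m0 : MeasurableSpace Ω} {μ : Measure Ω}
    {X : Ω → ℝ} (hX : AEMeasurable X μ) (hX0 : ∀ ω, 0 ≤ X ω)
    {C a η : ℝ} (hC : 0 ≤ C) (hη : 0 ≤ η) (hηa : η < a)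
    (htail : ∀ t : ℝ, 0 ≤ t → μ {ω | t < X ω} ≤ ENNReal.ofReal (C * Real.exp (-a * t))) :
    ∫⁻ ω, ENNReal.ofReal (Real.exp (η * X ω) - 1 - η * X ω) ∂μ
      ≤ ENNReal.ofReal (C * η ^ 2 / (a * (a - η))) := by
  have ha : 0 < a := hη.trans_lt hηa
  have hexp : ∀ t : ℝ, 0 < t → 0 ≤ η * (Real.exp (η * t) - 1) := fun t ht =>
    mul_nonneg hη (sub_nonneg.2 (Real.one_le_exp (mul_nonneg hη ht.le)))
  have hlayer := lintegral_comp_eq_lintegral_meas_lt_mul μ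
    (f := X) (g := fun t => η * (Real.exp (η * t) - 1)) (Filter.Eventually.of_forall hX0) hX
    (fun t _ => Continuous.intervalIntegrable (by fun_prop) _ _)
    ((ae_restrict_iff' measurableSet_Ioi).2 (Filter.Eventually.of_forall hexp))
  simp only [intervalIntegral_mul_exp_sub_one] at hlayer
  rw [hlayer]
  have hsplit : ∀ t : ℝ, C * Real.exp (-a * t) * (η * (Real.exp (η * t) - 1))
      = C * η * (Real.exp (-(a - η) * t) - Real.exp (-a * t)) := by
    intro t
    rw [show -(a - η) * t = -a * t + η * t by ring, Real.exp_add]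
    ring
  have hint₁ : IntegrableOn (fun t : ℝ => Real.exp (-(a - η) * t)) (Set.Ioi 0) :=
    integrableOn_exp_mul_Ioi (by linarith) 0
  have hint₂ : IntegrableOn (fun t : ℝ => Real.exp (-a * t)) (Set.Ioi 0) :=
    integrableOn_exp_mul_Ioi (by linarith) 0
  calc
    _ ≤ ∫⁻ t in Set.Ioi (0 : ℝ),
          ENNReal.ofReal (C * η * (Real.exp (-(a - η) * t) - Real.exp (-a * t))) := by
      refine setLIntegral_mono' measurableSet_Ioi fun t ht => ?_
      rw [← hsplit, ENNReal.ofReal_mul (mul_nonneg hC (Real.exp_nonneg _))]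
      gcongr
      exact htail t (le_of_lt ht)
    _ = ENNReal.ofReal (∫ t in Set.Ioi (0 : ℝ),
          C * η * (Real.exp (-(a - η) * t) - Real.exp (-a * t))) := by
      refine (ofReal_integral_eq_lintegral_ofReal ((hint₁.sub hint₂).const_mul _) ?_).symm
      refine (ae_restrict_iff' measurableSet_Ioi).2 (Filter.Eventually.of_forall fun t ht => ?_)
      simp only [Pi.zero_apply, Pi.sub_apply]
      rw [← hsplit]
      exact mul_nonneg (mul_nonneg hC (Real.exp_nonneg _)) (hexp t ht)
    _ = _ := by
      rw [integral_const_mul, integral_sub hint₁ hint₂,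
        integral_exp_mul_Ioi (by linarith), integral_exp_mul_Ioi (by linarith)]
      congr 1
      have : a - η ≠ 0 := by linarith
      simp only [mul_zero, Real.exp_zero]
      field_simp
      ring

/-- If `Z` has unit second moment and its square satisfies the subexponential tail
bound `Pr[Z² > t] ≤ 2 exp(−t/(2γ))` for all `t ≥ 0` (with `γ > 0`), then for every
`0 ≤ η < 1/(2γ)`, `𝔼[exp(ηZ²)] ≤ exp(η + 8η²γ²/(1 − 2ηγ))`. -/
theorem mgf_sq_of_tail_bound
    {Ω : Type*} {m0 : MeasurableSpace Ω} {μ : Measure Ω} [IsProbabilityMeasure μ]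
    (Z : Ω → ℝ) (hZmeas : Measurable Z)
    (γ : ℝ) (hγ : 0 < γ)
    (hsqint : Integrable (fun ω => Z ω ^ 2) μ)
    (hmom : ∫ ω, Z ω ^ 2 ∂μ = 1)
    (htail : ∀ t : ℝ, 0 ≤ t →
      μ {ω | Z ω ^ 2 > t} ≤ ENNReal.ofReal (2 * Real.exp (-t / (2 * γ))))
    (η : ℝ) (hη₀ : 0 ≤ η) (hη₁ : η < 1 / (2 * γ)) :
    ∫ ω, Real.exp (η * Z ω ^ 2) ∂μ
      ≤ Real.exp (η + 8 * η ^ 2 * γ ^ 2 / (1 - 2 * η * γ)) := by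
  have hden : 0 < 1 - 2 * η * γ := by
    rw [lt_div_iff₀ (by positivity)] at hη₁
    linarith
  have hremainder := lintegral_exp_remainder_le_of_tail_bound (X := fun ω => Z ω ^ 2)
    (hZmeas.pow_const 2).aemeasurable (fun ω => sq_nonneg _) zero_le_two hη₀ hη₁
    (fun t ht => by
      convert htail t ht using 4
      ring)
  have hvalue : 2 * η ^ 2 / (1 / (2 * γ) * (1 / (2 * γ) - η))
      = 8 * η ^ 2 * γ ^ 2 / (1 - 2 * η * γ) := by
    have : 1 / (2 * γ) - η = (1 - 2 * η * γ) / (2 * γ) := by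
      field_simp
    rw [this]
    field_simp
    ring
  rw [hvalue] at hremainder
  have hnonneg : ∀ ω, 0 ≤ Real.exp (η * Z ω ^ 2) - 1 - η * Z ω ^ 2 := fun ω => by
    linarith [Real.add_one_le_exp (η * Z ω ^ 2)]
  have hmeas : Measurable fun ω => Real.exp (η * Z ω ^ 2) - 1 - η * Z ω ^ 2 := by fun_prop
  have hint : Integrable (fun ω => Real.exp (η * Z ω ^ 2) - 1 - η * Z ω ^ 2) μ :=
    (lintegral_ofReal_ne_top_iff_integrable hmeas.aestronglyMeasurable
      (Filter.Eventually.of_forall hnonneg)).1 (hremainder.trans_lt ENNReal.ofReal_lt_top).ne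
  have hle : ∫ ω, (Real.exp (η * Z ω ^ 2) - 1 - η * Z ω ^ 2) ∂μ
      ≤ 8 * η ^ 2 * γ ^ 2 / (1 - 2 * η * γ) := by
    rw [integral_eq_lintegral_of_nonneg_ae (Filter.Eventually.of_forall hnonneg)
      hmeas.aestronglyMeasurable]
    exact ENNReal.toReal_le_of_le_ofReal (by positivity) hremainder
  calc ∫ ω, Real.exp (η * Z ω ^ 2) ∂μ
      = ∫ ω, ((Real.exp (η * Z ω ^ 2) - 1 - η * Z ω ^ 2) + (1 + η * Z ω ^ 2)) ∂μ := by
        congr 1 with ω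
        ring
    _ = ∫ ω, (Real.exp (η * Z ω ^ 2) - 1 - η * Z ω ^ 2) ∂μ + (1 + η) := by
        have hlin : Integrable (fun ω => 1 + η * Z ω ^ 2) μ :=
          (integrable_const 1).add (hsqint.const_mul η)
        rw [integral_add hint hlin,
          integral_add (integrable_const 1) (hsqint.const_mul η), integral_const_mul, hmom]
        simp
    _ ≤ η + 8 * η ^ 2 * γ ^ 2 / (1 - 2 * η * γ) + 1 := by linarith
    _ ≤ _ := Real.add_one_le_exp _
end
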